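/- arXiv:math/0401090 — 7 statements merged into one kernel-verified Lean document; each statement's English description precedes it below -/
import Mathlib

section
/- For all n ≥ 2, the number of upper sets S of the root poset of type D_n with S ∩ Π = ∅ equals C(2n−2, n−2) + C(2n−3, n−3), where C(a,b) denotes the binomial coefficient. -/
/-- The standard basis vector `e i` of `ℤ^n`. -/
def stdD (n : ℕ) (i : Fin n) : Fin n → ℤ := Pi.single i 1

/-- The set of positive roots of type `D_n`:
`e i - e j` and `e i + e j` for `i < j`. -/
def posD (n : ℕ) : Set (Fin n → ℤ) :=
  {x | (∃ i j : Fin n, i < j ∧ x = stdD n i - stdD n j) ∨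
    (∃ i j : Fin n, i < j ∧ x = stdD n i + stdD n j)}

/-- The set of simple roots of type `D_n`: `α i = e i - e (i+1)` for `i < n - 1`
together with the last simple root `e (n-2) + e (n-1)`. -/
def simpleD (n : ℕ) : Set (Fin n → ℤ) :=
  {x | (∃ i j : Fin n, (i : ℕ) + 1 = (j : ℕ) ∧ x = stdD n i - stdD n j) ∨
    (∃ i j : Fin n, (i : ℕ) + 1 = (j : ℕ) ∧ (j : ℕ) + 1 = n ∧ x = stdD n i + stdD n j)}

/-- The root poset order of type `D_n`. -/
def rootLeD (n : ℕ) (a b : Fin n → ℤ) : Prop :=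
  b - a ∈ AddSubmonoid.closure (simpleD n)

/-- `S` is an upper set of the root poset of type `D_n`. -/
def isUpperD (n : ℕ) (S : Set (Fin n → ℤ)) : Prop :=
  S ⊆ posD n ∧ ∀ a ∈ S, ∀ b ∈ posD n, rootLeD n a b → b ∈ S

/-- Binomial coefficient `C(a, b)` for integers, taken to be `0` when
`b < 0` or `b > a`. -/
def intBinom (a b : ℤ) : ℤ :=
  if 0 ≤ b ∧ b ≤ a then (a.toNat.choose b.toNat : ℤ) else 0

namespace DCount

/-- Upper sets of `Q` for the relation `r`. -/
def ups {α : Type*} (r : α → α → Prop) (Q : Set α) : Set (Set α) :=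
  {U | U ⊆ Q ∧ ∀ a ∈ U, ∀ b ∈ Q, r a b → b ∈ U}

lemma ups_finite {α : Type*} (r : α → α → Prop) {Q : Set α} (hQ : Q.Finite) :
    (ups r Q).Finite :=
  hQ.finite_subsets.subset (fun _ hU => hU.1)

lemma ups_empty {α : Type*} (r : α → α → Prop) : (ups r ∅).ncard = 1 := by
  rw [Set.ncard_eq_one]
  refine ⟨∅, ?_⟩
  ext U
  simp only [ups, Set.mem_ofPred_eq, Set.mem_singleton_iff, Set.subset_empty_iff]
  constructor
  · exact fun h => h.1
  · rintro rfl; simp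

/-- Peeling lemma: split on whether `x` belongs to the upper set. -/
lemma ups_peel {α : Type*} (r : α → α → Prop) (hrefl : ∀ a, r a a)
    (htr : ∀ a b c, r a b → r b c → r a c) (Q : Set α) (hQ : Q.Finite) (x : α) (hx : x ∈ Q)
    (A B : Set α) (hA : A = {y ∈ Q | ¬ r y x}) (hB : B = {y ∈ Q | ¬ r x y}) :
    (ups r Q).ncard = (ups r A).ncard + (ups r B).ncard := by
  have hAQ : A ⊆ Q := by rw [hA]; exact Set.sep_subset _ _
  have hBQ : B ⊆ Q := by rw [hB]; exact Set.sep_subset _ _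
  have key : ups r Q = ups r A ∪ (fun U => U ∪ {y ∈ Q | r x y}) '' (ups r B) := by
    ext U
    constructor
    · rintro ⟨h1, h2⟩
      by_cases hxU : x ∈ U
      · right
        refine ⟨U ∩ B, ⟨Set.inter_subset_right, ?_⟩, ?_⟩
        · intro a ha b hb hab
          exact ⟨h2 a ha.1 b (hBQ hb) hab, hb⟩
        · ext y
          simp only [Set.mem_union, Set.mem_inter_iff, hB, Set.mem_ofPred_eq]
          constructor
          · rintro (h | h)
            · exact h.1
            · exact h2 x hxU y h.1 h.2
          · intro hy
            have := h1 hy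
            tauto
      · left
        refine ⟨?_, fun a ha b hb hab => h2 a ha b (hAQ hb) hab⟩
        intro y hy
        rw [hA]
        exact ⟨h1 hy, fun hyx => hxU (h2 y hy x hx hyx)⟩
    · rintro (⟨h1, h2⟩ | ⟨V, ⟨h1, h2⟩, rfl⟩)
      · refine ⟨h1.trans hAQ, fun a ha b hb hab => h2 a ha b ?_ hab⟩
        have haA := h1 ha
        rw [hA] at haA ⊢
        exact ⟨hb, fun hbx => haA.2 (htr _ _ _ hab hbx)⟩
      · refine ⟨Set.union_subset (h1.trans hBQ) (Set.sep_subset _ _), ?_⟩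
        rintro a (ha | ha) b hb hab
        · by_cases hxb : r x b
          · exact Or.inr ⟨hb, hxb⟩
          · left
            exact h2 a ha b (by rw [hB]; exact ⟨hb, hxb⟩) hab
        · exact Or.inr ⟨hb, htr _ _ _ ha.2 hab⟩
  have hfA := ups_finite r (hQ.subset hAQ)
  have hfB := ups_finite r (hQ.subset hBQ)
  rw [key, Set.ncard_union_eq ?_ hfA (hfB.image _), Set.InjOn.ncard_image]
  · intro U hU V hV h
    have h' : ∀ y, (y ∈ U ∨ (y ∈ Q ∧ r x y)) ↔ (y ∈ V ∨ (y ∈ Q ∧ r x y)) := fun y => by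
      have := Set.ext_iff.1 h y
      simpa using this
    have hU1 := hU.1
    have hV1 := hV.1
    rw [hB] at hU1 hV1
    ext y
    have a1 := h' y
    constructor
    · intro hy
      have := (hU1 hy).2
      tauto
    · intro hy
      have := (hV1 hy).2
      tauto
  · rw [Set.disjoint_left]
    rintro U hU ⟨V, hV, rfl⟩
    have := hU.1 (Or.inr ⟨hx, hrefl x⟩ : x ∈ V ∪ {y ∈ Q | r x y})
    rw [hA] at this
    exact this.2 (hrefl x)

/-- Transport of upper sets along an order embedding. -/
lemma ups_image {α β : Type*} (r : α → α → Prop) (r' : β → β → Prop) (Q : Set α) (f : α → β)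
    (hinj : Set.InjOn f Q) (hr : ∀ a ∈ Q, ∀ b ∈ Q, (r' (f a) (f b) ↔ r a b)) :
    (ups r' (f '' Q)).ncard = (ups r Q).ncard := by
  have : ups r' (f '' Q) = (fun U => f '' U) '' ups r Q := by
    ext V
    constructor
    · rintro ⟨h1, h2⟩
      refine ⟨{a ∈ Q | f a ∈ V}, ⟨Set.sep_subset _ _, ?_⟩, ?_⟩
      · intro a ha b hb hab
        exact ⟨hb, h2 _ ha.2 _ ⟨b, hb, rfl⟩ ((hr a ha.1 b hb).2 hab)⟩
      · ext y
        constructor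
        · rintro ⟨a, ha, rfl⟩; exact ha.2
        · intro hy
          obtain ⟨a, ha, rfl⟩ := h1 hy
          exact ⟨a, ⟨ha, hy⟩, rfl⟩
    · rintro ⟨U, ⟨h1, h2⟩, rfl⟩
      refine ⟨Set.image_mono h1, ?_⟩
      rintro _ ⟨a, ha, rfl⟩ _ ⟨b, hb, rfl⟩ hab
      exact ⟨b, h2 a ha b hb ((hr a (h1 ha) b hb).1 hab), rfl⟩
  rw [this, Set.InjOn.ncard_image]
  intro U hU V hV h
  exact (hinj.image_eq_image_iff hU.1 hV.1).1 h

/-- Combinatorial model of roots: `(false,i,j)` is `e i - e j`, `(true,i,j)` is `e i + e j`. -/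
abbrev Rt := Bool × ℕ × ℕ

/-- The order on the model, for `n = N + 2`. -/
def le (N : ℕ) : Rt → Rt → Prop
  | (false, i, j), (false, i', j') => i' ≤ i ∧ j ≤ j'
  | (true, i, j), (true, i', j') => i' ≤ i ∧ j' ≤ j
  | (false, i, j), (true, i', j') => i' ≤ i ∧ (j ≤ N ∨ j' ≤ N)
  | (true, _, _), (false, _, _) => False

lemma le_refl' (N : ℕ) (a : Rt) : le N a a := by
  obtain ⟨_ | _, i, j⟩ := a <;> simp [le]

lemma le_trans' (N : ℕ) (a b c : Rt) : le N a b → le N b c → le N a c := by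
  obtain ⟨_ | _, i, j⟩ := a <;> obtain ⟨_ | _, i', j'⟩ := b <;>
    obtain ⟨_ | _, i'', j''⟩ := c <;> simp only [le] <;> grind

/-- Region described by a predicate on minus roots and one on plus roots, with bounded indices. -/
def reg (N : ℕ) (p q : ℕ → ℕ → Prop) : Set Rt :=
  {x | (x.1 = false ∧ p x.2.1 x.2.2 ∨ x.1 = true ∧ q x.2.1 x.2.2) ∧ x.2.1 < x.2.2 ∧ x.2.2 ≤ N + 1}

lemma reg_finite (N : ℕ) (p q : ℕ → ℕ → Prop) : (reg N p q).Finite := by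
  refine Set.Finite.subset
    (Set.finite_univ.prod ((Set.finite_Iic (N+1)).prod (Set.finite_Iic (N+1)))) ?_
  rintro ⟨s, i, j⟩ ⟨_, h1, h2⟩
  simp only [Set.mem_prod, Set.mem_univ, Set.mem_Iic, true_and] at *
  omega

/-- Number of upper sets of a region. -/
noncomputable def cnt (N : ℕ) (p q : ℕ → ℕ → Prop) : ℕ := (ups (le N) (reg N p q)).ncard

lemma cnt_congr (N : ℕ) (p q p' q' : ℕ → ℕ → Prop)
    (hp : ∀ i j, i < j → j ≤ N + 1 → (p i j ↔ p' i j))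
    (hq : ∀ i j, i < j → j ≤ N + 1 → (q i j ↔ q' i j)) : cnt N p q = cnt N p' q' := by
  have : reg N p q = reg N p' q' := by
    ext ⟨s, i, j⟩
    have h1 := hp i j
    have h2 := hq i j
    simp only [reg, Set.mem_ofPred_eq]
    cases s <;> simp <;> tauto
  rw [cnt, cnt, this]

lemma cnt_empty (N : ℕ) (p q : ℕ → ℕ → Prop)
    (hp : ∀ i j, i < j → j ≤ N + 1 → ¬ p i j)
    (hq : ∀ i j, i < j → j ≤ N + 1 → ¬ q i j) : cnt N p q = 1 := by
  have : reg N p q = ∅ := by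
    ext ⟨s, i, j⟩
    have h1 := hp i j
    have h2 := hq i j
    simp only [reg, Set.mem_ofPred_eq, Set.mem_empty_iff_false, iff_false]
    cases s <;> simp <;> grind
  rw [cnt, this, ups_empty]

/-- Peeling at a minus root. -/
lemma peel_minus (N : ℕ) (p q p1 q1 p2 q2 : ℕ → ℕ → Prop) (a b : ℕ) (hab : a < b)
    (hb : b ≤ N + 1) (hx : p a b)
    (hp1 : ∀ i j, i < j → j ≤ N + 1 → (p1 i j ↔ p i j ∧ ¬ (a ≤ i ∧ j ≤ b)))
    (hq1 : ∀ i j, i < j → j ≤ N + 1 → (q1 i j ↔ q i j))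
    (hp2 : ∀ i j, i < j → j ≤ N + 1 → (p2 i j ↔ p i j ∧ ¬ (i ≤ a ∧ b ≤ j)))
    (hq2 : ∀ i j, i < j → j ≤ N + 1 → (q2 i j ↔ q i j ∧ ¬ (i ≤ a ∧ (b ≤ N ∨ j ≤ N)))) :
    cnt N p q = cnt N p1 q1 + cnt N p2 q2 := by
  apply ups_peel (le N) (le_refl' N) (le_trans' N) _ (reg_finite N p q) (false, a, b)
  · exact ⟨Or.inl ⟨rfl, hx⟩, hab, hb⟩
  · ext ⟨s, i, j⟩
    have h1 := hp1 i j
    have h2 := hq1 i j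
    simp only [reg, Set.mem_ofPred_eq]
    cases s <;> simp [le] <;> grind
  · ext ⟨s, i, j⟩
    have h1 := hp2 i j
    have h2 := hq2 i j
    simp only [reg, Set.mem_ofPred_eq]
    cases s <;> simp [le] <;> grind

/-- Peeling at a plus root. -/
lemma peel_plus (N : ℕ) (p q p1 q1 p2 q2 : ℕ → ℕ → Prop) (a b : ℕ) (hab : a < b)
    (hb : b ≤ N + 1) (hx : q a b)
    (hp1 : ∀ i j, i < j → j ≤ N + 1 → (p1 i j ↔ p i j ∧ ¬ (a ≤ i ∧ (j ≤ N ∨ b ≤ N))))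
    (hq1 : ∀ i j, i < j → j ≤ N + 1 → (q1 i j ↔ q i j ∧ ¬ (a ≤ i ∧ b ≤ j)))
    (hp2 : ∀ i j, i < j → j ≤ N + 1 → (p2 i j ↔ p i j))
    (hq2 : ∀ i j, i < j → j ≤ N + 1 → (q2 i j ↔ q i j ∧ ¬ (i ≤ a ∧ j ≤ b))) :
    cnt N p q = cnt N p1 q1 + cnt N p2 q2 := by
  apply ups_peel (le N) (le_refl' N) (le_trans' N) _ (reg_finite N p q) (true, a, b)
  · exact ⟨Or.inr ⟨rfl, hx⟩, hab, hb⟩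
  · ext ⟨s, i, j⟩
    have h1 := hp1 i j
    have h2 := hq1 i j
    simp only [reg, Set.mem_ofPred_eq]
    cases s <;> simp [le] <;> grind
  · ext ⟨s, i, j⟩
    have h1 := hp2 i j
    have h2 := hq2 i j
    simp only [reg, Set.mem_ofPred_eq]
    cases s <;> simp [le] <;> grind

/-- Shifted triangles have `2 ^ k` upper sets. -/
lemma cnt_V (N : ℕ) : ∀ k a b, b = a + k → b ≤ N →
    cnt N (fun _ _ => False) (fun i j => a ≤ i ∧ j ≤ b) = 2 ^ k := by
  intro k
  induction k with
  | zero =>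
    intro a b hb hN
    apply cnt_empty <;> intros <;> first | omega | grind
  | succ k ih =>
    intro a b hb hN
    rw [peel_plus N _ _ (fun _ _ => False) (fun i j => a ≤ i ∧ j ≤ b - 1)
      (fun _ _ => False) (fun i j => a + 1 ≤ i ∧ j ≤ b) a b (by omega) (by omega) (by omega),
      ih a (b - 1) (by omega) (by omega), ih (a + 1) b (by omega) (by omega), pow_succ]
    · omega
    all_goals intros; first | omega | grind

lemma cnt_Tr (N : ℕ) : ∀ k a, a + k = N →
    cnt N (fun _ _ => False) (fun i _ => a ≤ i ∧ i < N) + 1 = 2 ^ (k + 1) := by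
  intro k
  induction k with
  | zero =>
    intro a hN
    rw [cnt_empty] <;> intros <;> first | omega | grind
  | succ k ih =>
    intro a hN
    have e := ih (a + 1) (by omega)
    have v := cnt_V N (k + 1) a N (by omega) (by omega)
    rw [peel_plus N _ _ (fun _ _ => False) (fun i j => a ≤ i ∧ j ≤ N)
      (fun _ _ => False) (fun i _ => a + 1 ≤ i ∧ i < N) a (N + 1) (by omega) (by omega) (by omega),
      v, add_assoc, e, pow_succ 2 (k + 1)]
    · omega
    all_goals intros; first | omega | grind

lemma cnt_Z3 (N : ℕ) : ∀ k a, a + k = N →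
    cnt N (fun i j => a ≤ i ∧ i < N ∧ j = N + 1) (fun i j => a ≤ i ∧ j ≤ N) + 1 = 2 ^ (k + 1) := by
  intro k
  induction k with
  | zero =>
    intro a hN
    rw [cnt_empty] <;> intros <;> first | omega | grind
  | succ k ih =>
    intro a hN
    have e := ih (a + 1) (by omega)
    have v := cnt_V N (k + 1) a N (by omega) (by omega)
    rw [peel_minus N _ _ (fun _ _ => False) (fun i j => a ≤ i ∧ j ≤ N)
      (fun i j => a + 1 ≤ i ∧ i < N ∧ j = N + 1) (fun i j => a + 1 ≤ i ∧ j ≤ N)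
      a (N + 1) (by omega) (by omega) (by omega),
      v, add_assoc, e, pow_succ 2 (k + 1)]
    · omega
    all_goals intros; first | omega | grind

/-- The main family of regions. -/
noncomputable def cR (N a c : ℕ) : ℕ :=
  cnt N (fun i j => a ≤ i ∧ c ≤ j ∧ i + 2 ≤ j) (fun i _ => a ≤ i ∧ i < N)

lemma cR_center (N : ℕ) : ∀ k a, a + k = N →
    cR N a (N + 1) + 2 * k + 5 = 3 * 2 ^ (k + 1) := by
  intro k
  induction k with
  | zero =>
    intro a hN
    rw [cR, cnt_empty] <;> intros <;> first | omega | grind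
  | succ k ih =>
    intro a hN
    have e := ih (a + 1) (by omega)
    have t := cnt_Tr N (k + 1) a (by omega)
    have z := cnt_Z3 N k (a + 1) (by omega)
    rw [cR] at *
    rw [peel_minus N _ _ (fun _ _ => False) (fun i _ => a ≤ i ∧ i < N)
      (fun i j => a + 1 ≤ i ∧ i < N ∧ j = N + 1)
      (fun i j => (a ≤ i ∧ i < N ∧ j = N + 1) ∨ (a + 1 ≤ i ∧ j ≤ N))
      a (N + 1) (by omega) (by omega) (by omega),
      peel_plus N (fun i j => a + 1 ≤ i ∧ i < N ∧ j = N + 1)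
      (fun i j => (a ≤ i ∧ i < N ∧ j = N + 1) ∨ (a + 1 ≤ i ∧ j ≤ N))
      (fun i j => a + 1 ≤ i ∧ i < N ∧ j = N + 1) (fun i j => a + 1 ≤ i ∧ j ≤ N)
      (fun i j => a + 1 ≤ i ∧ N + 1 ≤ j ∧ i + 2 ≤ j) (fun i _ => a + 1 ≤ i ∧ i < N)
      a (N + 1) (by omega) (by omega) (by omega)]
    · rw [pow_succ 2 (k + 1)] at *
      omega
    all_goals intros; first | omega | grind

lemma cR_step (N a c : ℕ) (h : a + 2 ≤ c) (hc : c ≤ N) :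
    cR N a c = cR N a (c + 1) + cR N (a + 1) c := by
  unfold cR
  apply peel_minus N _ _ _ _ _ _ a c (by omega) (by omega) (by omega)
  all_goals intros; first | omega | grind

lemma cR_diag (N a : ℕ) : cR N a (a + 1) = cR N a (a + 2) := by
  unfold cR
  apply cnt_congr <;> intros <;> first | omega | grind

/-- A Pascal-type array. -/
def cc (s : ℕ) : ℕ → ℕ
  | 0 => 1
  | u + 1 => s.choose (u + 1) + 2 * s.choose u

lemma cc_pascal (s u : ℕ) : cc (s + 1) (u + 1) = cc s u + cc s (u + 1) := by
  cases u with
  | zero => simp [cc]; omega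
  | succ u => simp only [cc, Nat.choose_succ_succ' s]; ring

def F (h t : ℕ) : ℕ := ∑ v ∈ Finset.range (h + 1), cc (2 * t + h + 1) (t + v)

lemma F_center (h : ℕ) : F h 0 + 2 * h + 5 = 3 * 2 ^ (h + 1) := by
  have h1 := Nat.sum_range_choose (h + 1)
  rw [Finset.sum_range_succ, Finset.sum_range_succ] at h1
  have h2 := Nat.sum_range_choose (h + 1)
  rw [Finset.sum_range_succ, Finset.sum_range_succ'] at h2
  unfold F
  rw [Finset.sum_range_succ']
  simp only [Nat.mul_zero, Nat.zero_add]
  simp only [cc, Finset.sum_add_distrib, ← Finset.mul_sum]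
  simp only [Nat.choose_self, Nat.choose_succ_self_right, Nat.choose_zero_right] at h1 h2
  omega

lemma F_zero (t : ℕ) : F 0 (t + 1) = F 1 t := by
  simp only [F, Finset.sum_range_succ, Finset.sum_range_zero]
  rw [show 2 * (t + 1) + 0 + 1 = (2 * t + 1 + 1) + 1 by ring, Nat.add_zero, cc_pascal]
  simp

lemma F_step (h t : ℕ) : F (h + 1) (t + 1) = F (h + 2) t + F h (t + 1) := by
  unfold F
  have e : ∀ v, cc (2 * (t + 1) + (h + 1) + 1) (t + 1 + v)
      = cc (2 * t + h + 3) (t + v) + cc (2 * t + h + 3) (t + v + 1) := fun v => by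
    rw [← cc_pascal]; congr 1 <;> ring
  simp only [e, Finset.sum_add_distrib]
  rw [show 2 * t + (h + 2) + 1 = 2 * t + h + 3 by ring,
    show 2 * (t + 1) + h + 1 = 2 * t + h + 3 by ring,
    Finset.sum_range_succ (fun v => cc (2 * t + h + 3) (t + v + 1)),
    Finset.sum_range_succ (fun v => cc (2 * t + h + 3) (t + v)) (h + 2)]
  have : ∀ v, t + 1 + v = t + v + 1 := fun v => by ring
  simp only [this]
  rw [show t + (h + 2) = t + (h + 1) + 1 by ring]
  ring

lemma cR_eq (N : ℕ) : ∀ t h a, a + h + t = N → cR N a (a + h + 1) = F h t := by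
  intro t
  induction t with
  | zero =>
    intro h a hN
    have e1 := cR_center N h a (by omega)
    have e2 := F_center h
    rw [show a + h + 1 = N + 1 by omega]
    omega
  | succ t iht =>
    intro h
    induction h with
    | zero =>
      intro a hN
      rw [F_zero, ← iht 1 a (by omega)]
      exact cR_diag N a
    | succ h ihh =>
      intro a hN
      rw [F_step, ← iht (h + 2) a (by omega), ← ihh (a + 1) (by omega),
        cR_step N a _ (by omega) (by omega)]
      congr 2
      ring

/-- Basis vectors indexed by natural numbers. -/
def ee (n i : ℕ) : Fin n → ℤ := fun k => if (k : ℕ) = i then 1 else 0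

lemma stdD_eq (n : ℕ) (i : Fin n) : stdD n i = ee n i := by
  ext k
  simp [stdD, ee, Pi.single_apply, Fin.ext_iff]

/-- Realization of the model as vectors. -/
def phi (n : ℕ) : Rt → Fin n → ℤ
  | (false, i, j) => ee n i - ee n j
  | (true, i, j) => ee n i + ee n j

/-- Weight functionals. -/
def L (n : ℕ) (w : ℕ → ℤ) (x : Fin n → ℤ) : ℤ := ∑ l : Fin n, w l * x l

lemma L_add (n : ℕ) (w : ℕ → ℤ) (x y) : L n w (x + y) = L n w x + L n w y := by
  simp [L, mul_add, Finset.sum_add_distrib]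

lemma L_sub (n : ℕ) (w : ℕ → ℤ) (x y) : L n w (x - y) = L n w x - L n w y := by
  simp [L, mul_sub, Finset.sum_sub_distrib]

lemma L_ee (n : ℕ) (w : ℕ → ℤ) (i : ℕ) (hi : i < n) : L n w (ee n i) = w i := by
  unfold L ee
  rw [Finset.sum_eq_single (⟨i, hi⟩ : Fin n)]
  · simp
  · intro b _ hb
    have : (b : ℕ) ≠ i := fun h => hb (Fin.ext h)
    simp [this]
  · simp

lemma L_nonneg (n : ℕ) (w : ℕ → ℤ) (h1 : ∀ i, i + 1 < n → 0 ≤ w i - w (i + 1))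
    (h2 : ∀ i, i + 2 = n → 0 ≤ w i + w (i + 1)) (x : Fin n → ℤ)
    (hx : x ∈ AddSubmonoid.closure (simpleD n)) : 0 ≤ L n w x := by
  induction hx using AddSubmonoid.closure_induction with
  | mem x hx =>
    rcases hx with ⟨i, j, hij, rfl⟩ | ⟨i, j, hij, hj, rfl⟩
    · rw [stdD_eq, stdD_eq, L_sub, L_ee _ _ _ i.2, L_ee _ _ _ j.2, ← hij]
      exact h1 _ (by omega)
    · rw [stdD_eq, stdD_eq, L_add, L_ee _ _ _ i.2, L_ee _ _ _ j.2, ← hij]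
      exact h2 _ (by omega)
  | zero => simp [L]
  | add x y _ _ hx hy => rw [L_add]; omega

lemma sub_mem_cl (n : ℕ) (i k : ℕ) (h : i + k < n) :
    ee n i - ee n (i + k) ∈ AddSubmonoid.closure (simpleD n) := by
  induction k with
  | zero => simp [AddSubmonoid.zero_mem]
  | succ k ih =>
    have h1 := ih (by omega)
    have h2 : ee n (i + k) - ee n (i + (k + 1)) ∈ AddSubmonoid.closure (simpleD n) := by
      apply AddSubmonoid.subset_closure
      left
      exact ⟨⟨i + k, by omega⟩, ⟨i + (k + 1), h⟩, by simp; omega, by rw [stdD_eq, stdD_eq]⟩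
    have := AddSubmonoid.add_mem _ h1 h2
    simpa using this

lemma sub_mem (n : ℕ) (i j : ℕ) (hij : i ≤ j) (h : j < n) :
    ee n i - ee n j ∈ AddSubmonoid.closure (simpleD n) := by
  obtain ⟨k, rfl⟩ := Nat.exists_eq_add_of_le hij
  exact sub_mem_cl n i k h

lemma add_mem' (N : ℕ) (i j : ℕ) (hi : i ≤ N) (hj : j ≤ N + 1) :
    ee (N + 2) i + ee (N + 2) j ∈ AddSubmonoid.closure (simpleD (N + 2)) := by
  have h1 := sub_mem (N + 2) i N hi (by omega)
  have h2 := sub_mem (N + 2) j (N + 1) hj (by omega)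
  have h3 : ee (N + 2) N + ee (N + 2) (N + 1) ∈ AddSubmonoid.closure (simpleD (N + 2)) := by
    apply AddSubmonoid.subset_closure
    right
    exact ⟨⟨N, by omega⟩, ⟨N + 1, by omega⟩, rfl, rfl, by rw [stdD_eq, stdD_eq]⟩
  have := AddSubmonoid.add_mem _ (AddSubmonoid.add_mem _ h1 h2) h3
  convert this using 1
  abel

lemma phi_le (N : ℕ) (x y : Rt) (hx : x.2.1 < x.2.2) (hx' : x.2.2 ≤ N + 1)
    (hy : y.2.1 < y.2.2) (hy' : y.2.2 ≤ N + 1) :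
    rootLeD (N + 2) (phi (N + 2) x) (phi (N + 2) y) ↔ le N x y := by
  obtain ⟨s, i, j⟩ := x
  obtain ⟨s', i', j'⟩ := y
  simp only at hx hx' hy hy'
  constructor
  · intro h
    have hp : ∀ k : ℕ, 0 ≤ L (N + 2) (fun l => if l ≤ k then 1 else 0)
        (phi (N + 2) (s', i', j') - phi (N + 2) (s, i, j)) := by
      intro k
      refine L_nonneg _ _ ?_ ?_ _ h <;> intros <;> grind
    have hq : 0 ≤ L (N + 2) (fun l => if l = N + 1 then -1 else 1)
        (phi (N + 2) (s', i', j') - phi (N + 2) (s, i, j)) := by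
      refine L_nonneg _ _ ?_ ?_ _ h <;> intros <;> grind
    have a1 := hp i
    have a2 := hp j
    have a3 := hp (j - 1)
    have a4 := hp (N + 1)
    clear hp h
    cases s <;> cases s' <;> simp only [phi, L_sub, L_add, L_ee (N + 2) _ i (by omega),
      L_ee (N + 2) _ j (by omega), L_ee (N + 2) _ i' (by omega),
      L_ee (N + 2) _ j' (by omega)] at a1 a2 a3 a4 hq <;> simp only [le]
    · clear a2 a4 hq
      refine ⟨?_, ?_⟩
      · clear a3
        grind
      · clear a1
        grind
    · clear a2 a3 a4
      refine ⟨?_, ?_⟩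
      · clear hq
        grind
      · clear a1
        grind
    · clear a1 a2 a3 hq
      grind
    · clear a3 a4 hq
      refine ⟨?_, ?_⟩
      · clear a2
        grind
      · clear a1
        grind
  · intro h
    unfold rootLeD
    cases s <;> cases s' <;> simp only [le] at h <;> simp only [phi]
    · have := AddSubmonoid.add_mem _ (sub_mem (N + 2) i' i h.1 (by omega))
        (sub_mem (N + 2) j j' h.2 (by omega))
      convert this using 1
      abel
    · have h2 : ee (N + 2) j + ee (N + 2) j' ∈ AddSubmonoid.closure (simpleD (N + 2)) := by
        rcases h.2 with h2 | h2
        · exact add_mem' N j j' h2 hy'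
        · rw [add_comm (ee (N + 2) j)]
          exact add_mem' N j' j h2 hx'
      have := AddSubmonoid.add_mem _ (sub_mem (N + 2) i' i h.1 (by omega)) h2
      convert this using 1
      abel
    · have := AddSubmonoid.add_mem _ (sub_mem (N + 2) i' i h.1 (by omega))
        (sub_mem (N + 2) j' j h.2 (by omega))
      convert this using 1
      abel

/-- All roots of the model. -/
def full (N : ℕ) : Set Rt := {x | x.2.1 < x.2.2 ∧ x.2.2 ≤ N + 1}

/-- Simple roots of the model. -/
def smpl (N : ℕ) : Set Rt := {x | (x.1 = false ∧ x.2.1 + 1 = x.2.2 ∨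
  x.1 = true ∧ x.2.1 = N ∧ x.2.2 = N + 1) ∧ x.2.2 ≤ N + 1}

lemma phi_inj (N : ℕ) : Set.InjOn (phi (N + 2)) (full N) := by
  intro x hx y hy h
  have h1 : le N x y := (phi_le N x y hx.1 hx.2 hy.1 hy.2).1 (by
    rw [h, rootLeD, sub_self]; exact AddSubmonoid.zero_mem _)
  have h2 : le N y x := (phi_le N y x hy.1 hy.2 hx.1 hx.2).1 (by
    rw [h, rootLeD, sub_self]; exact AddSubmonoid.zero_mem _)
  obtain ⟨_ | _, i, j⟩ := x <;> obtain ⟨_ | _, i', j'⟩ := y <;> simp only [le] at h1 h2 <;>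
    simp <;> omega

lemma posD_eq (N : ℕ) : posD (N + 2) = phi (N + 2) '' full N := by
  ext v
  constructor
  · rintro (⟨i, j, hij, rfl⟩ | ⟨i, j, hij, rfl⟩)
    · refine ⟨(false, i, j), ⟨hij, ?_⟩, by simp [phi, stdD_eq]⟩
      simp only; omega
    · refine ⟨(true, i, j), ⟨hij, ?_⟩, by simp [phi, stdD_eq]⟩
      simp only; omega
  · rintro ⟨⟨s, i, j⟩, ⟨h1, h2⟩, rfl⟩
    simp only at h1 h2
    cases s
    · left
      exact ⟨⟨i, by omega⟩, ⟨j, by omega⟩, h1, by simp [phi, stdD_eq]⟩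
    · right
      exact ⟨⟨i, by omega⟩, ⟨j, by omega⟩, h1, by simp [phi, stdD_eq]⟩

lemma simpleD_eq (N : ℕ) : simpleD (N + 2) = phi (N + 2) '' smpl N := by
  ext v
  constructor
  · rintro (⟨i, j, hij, rfl⟩ | ⟨i, j, hij, hj, rfl⟩)
    · refine ⟨(false, i, j), ⟨Or.inl ⟨rfl, hij⟩, ?_⟩, by simp [phi, stdD_eq]⟩
      simp only; omega
    · refine ⟨(true, i, j), ⟨Or.inr ⟨rfl, ?_, ?_⟩, ?_⟩, by simp [phi, stdD_eq]⟩ <;>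
        simp only <;> omega
  · rintro ⟨⟨s, i, j⟩, ⟨h1, h2⟩, rfl⟩
    simp only at h1 h2
    cases s
    · left
      exact ⟨⟨i, by omega⟩, ⟨j, by omega⟩, by simp at h1 ⊢; omega, by simp [phi, stdD_eq]⟩
    · right
      exact ⟨⟨i, by simp at h1; omega⟩, ⟨j, by omega⟩, by simp at h1 ⊢; omega,
        by simp at h1 ⊢; omega, by simp [phi, stdD_eq]⟩

lemma frozen_eq (N : ℕ) :
    {S : Set (Fin (N + 2) → ℤ) | isUpperD (N + 2) S ∧ S ∩ simpleD (N + 2) = ∅} =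
      ups (rootLeD (N + 2)) (phi (N + 2) '' (full N \ smpl N)) := by
  have hsub : smpl N ⊆ full N := by
    rintro ⟨s, i, j⟩ ⟨h1, h2⟩
    simp only at h1 h2
    refine ⟨?_, h2⟩
    simp only
    omega
  have hQ : phi (N + 2) '' (full N \ smpl N) = posD (N + 2) \ simpleD (N + 2) := by
    rw [posD_eq, simpleD_eq, (phi_inj N).image_sdiff_subset hsub]
  ext S
  constructor
  · rintro ⟨⟨h1, h2⟩, h3⟩
    rw [hQ]
    refine ⟨fun x hx => ⟨h1 hx, fun hs => ?_⟩, fun a ha b hb hab => h2 a ha b hb.1 hab⟩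
    have : x ∈ S ∩ simpleD (N + 2) := ⟨hx, hs⟩
    rw [h3] at this
    exact this
  · rintro ⟨h1, h2⟩
    refine ⟨⟨?_, ?_⟩, ?_⟩
    · rw [hQ] at h1
      exact fun x hx => (h1 hx).1
    · intro a ha b hb hab
      refine h2 a ha b ?_ hab
      rw [posD_eq] at hb
      obtain ⟨y, hy, rfl⟩ := hb
      obtain ⟨x, ⟨hx, hxs⟩, rfl⟩ := h1 ha
      refine ⟨y, ⟨hy, fun hys => hxs ?_⟩, rfl⟩
      rw [phi_le N x y hx.1 hx.2 hy.1 hy.2] at hab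
      obtain ⟨hx1, hx2⟩ := hx
      obtain ⟨hy1, hy2⟩ := hys
      obtain ⟨_ | _, i, j⟩ := x <;> obtain ⟨_ | _, i', j'⟩ := y <;> simp only [le] at hab <;>
        simp [smpl] at * <;> omega
    · rw [hQ] at h1
      ext x
      simp only [Set.mem_inter_iff, Set.mem_empty_iff_false, iff_false, not_and]
      exact fun hx => (h1 hx).2

lemma full_eq (N : ℕ) : full N \ smpl N =
    reg N (fun i j => 0 ≤ i ∧ 0 + 0 + 1 ≤ j ∧ i + 2 ≤ j) (fun i _ => 0 ≤ i ∧ i < N) := by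
  ext ⟨s, i, j⟩
  cases s <;> simp [full, smpl, reg] <;> omega

lemma main_count (N : ℕ) :
    Nat.card {S : Set (Fin (N + 2) → ℤ) //
      isUpperD (N + 2) S ∧ S ∩ simpleD (N + 2) = ∅} = cc (2 * N + 1) N := by
  have h := cR_eq N N 0 0 (by omega)
  change Set.ncard {S : Set (Fin (N + 2) → ℤ) |
      isUpperD (N + 2) S ∧ S ∩ simpleD (N + 2) = ∅} = _
  rw [frozen_eq, ups_image (le N) _ _ _ ((phi_inj N).mono Set.sdiff_subset), full_eq]
  · rw [cR, cnt] at h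
    rw [h]
    simp [F]
  · intro a ha b hb
    exact phi_le N a b ha.1.1 ha.1.2 hb.1.1 hb.1.2

end DCount

theorem stmt_9 (n : ℕ) (hn : 2 ≤ n) :
    (Nat.card {S : Set (Fin n → ℤ) // isUpperD n S ∧ S ∩ simpleD n = ∅} : ℤ) =
      intBinom (2 * (n : ℤ) - 2) ((n : ℤ) - 2) +
        intBinom (2 * (n : ℤ) - 3) ((n : ℤ) - 3) := by
  obtain ⟨N, rfl⟩ := Nat.exists_eq_add_of_le' hn
  rw [DCount.main_count]
  cases N with
  | zero => simp [DCount.cc, intBinom]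
  | succ N =>
    have e1 : (2 * ((N + 1 + 2 : ℕ) : ℤ) - 2) = ((2 * N + 4 : ℕ) : ℤ) := by push_cast; ring
    have e2 : (((N + 1 + 2 : ℕ) : ℤ) - 2) = ((N + 1 : ℕ) : ℤ) := by push_cast; ring
    have e3 : (2 * ((N + 1 + 2 : ℕ) : ℤ) - 3) = ((2 * N + 3 : ℕ) : ℤ) := by push_cast; ring
    have e4 : (((N + 1 + 2 : ℕ) : ℤ) - 3) = (N : ℤ) := by push_cast; ring
    rw [e1, e2, e3, e4, intBinom, intBinom, if_pos (by constructor <;> omega),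
      if_pos (by constructor <;> omega)]
    simp only [Int.toNat_natCast]
    rw [show 2 * N + 4 = (2 * N + 3) + 1 by ring, Nat.choose_succ_succ',
      show 2 * (N + 1) + 1 = 2 * N + 3 by ring, DCount.cc]
    push_cast
    ring
end

section
/- Every abelian upper set S of the root poset of type A_n contains at most one simple root, i.e. |S ∩ Π| ≤ 1. -/
/-- The standard basis vector `e i` of `ℤ^(n+1)`. -/
def stdA (n : ℕ) (i : Fin (n + 1)) : Fin (n + 1) → ℤ := Pi.single i 1

/-- The set of positive roots of type `A_n`: `e i - e j` for `i < j`. -/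
def posA (n : ℕ) : Set (Fin (n + 1) → ℤ) :=
  {x | ∃ i j : Fin (n + 1), i < j ∧ x = stdA n i - stdA n j}

/-- The set of simple roots of type `A_n`: `α i = e i - e (i+1)`. -/
def simpleA (n : ℕ) : Set (Fin (n + 1) → ℤ) :=
  {x | ∃ i j : Fin (n + 1), (i : ℕ) + 1 = (j : ℕ) ∧ x = stdA n i - stdA n j}

/-- The root poset order: `a ≤ b` iff `b - a` is a nonnegative integer
combination of simple roots, i.e. lies in the additive submonoid generated by them. -/
def rootLeA (n : ℕ) (a b : Fin (n + 1) → ℤ) : Prop :=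
  b - a ∈ AddSubmonoid.closure (simpleA n)

/-- `S` is an upper set of the root poset of type `A_n`. -/
def isUpperA (n : ℕ) (S : Set (Fin (n + 1) → ℤ)) : Prop :=
  S ⊆ posA n ∧ ∀ a ∈ S, ∀ b ∈ posA n, rootLeA n a b → b ∈ S
theorem std_sub_mem_closure (n : ℕ) (d : ℕ) : ∀ i j : Fin (n + 1), (i : ℕ) + d = (j : ℕ) →
    stdA n i - stdA n j ∈ AddSubmonoid.closure (simpleA n) := by
  induction d with
  | zero =>
    intro i j h
    have : i = j := Fin.ext (by omega)
    subst this
    simp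
  | succ d ih =>
    intro i j h
    have hj := j.isLt
    have h1 := ih i ⟨i + d, by omega⟩ rfl
    have h2 : stdA n ⟨i + d, by omega⟩ - stdA n j ∈ AddSubmonoid.closure (simpleA n) :=
      AddSubmonoid.subset_closure ⟨_, _, by simp only; omega, rfl⟩
    have h3 := AddSubmonoid.add_mem _ h1 h2
    rwa [sub_add_sub_cancel] at h3

theorem no_two_simple (n : ℕ) (S : Set (Fin (n + 1) → ℤ)) (hup : isUpperA n S)
    (hab : ∀ a ∈ S, ∀ b ∈ S, a + b ∉ posA n) (i j k l : Fin (n + 1))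
    (hij : (i : ℕ) + 1 = j) (hkl : (k : ℕ) + 1 = l) (hik : (i : ℕ) < k)
    (h1 : stdA n i - stdA n j ∈ S) (h2 : stdA n k - stdA n l ∈ S) : False := by
  have h3 : stdA n i - stdA n k ∈ S := by
    refine hup.2 _ h1 _ ⟨i, k, hik, rfl⟩ ?_
    unfold rootLeA
    rw [sub_sub_sub_cancel_left]
    exact std_sub_mem_closure n (k - j) j k (by omega)
  refine hab _ h3 _ h2 ⟨i, l, ?_, sub_add_sub_cancel _ _ _⟩
  exact Fin.lt_def.2 (by omega)

theorem stmt_11 (n : ℕ) (S : Set (Fin (n + 1) → ℤ)) (hup : isUpperA n S)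
    (hab : ∀ a ∈ S, ∀ b ∈ S, a + b ∉ posA n) :
    (S ∩ simpleA n).ncard ≤ 1 := by
  suffices hs : (S ∩ simpleA n).Subsingleton from (Set.ncard_le_one hs.finite).2 (fun a ha b hb => hs ha hb)
  rintro _ ⟨ha, i, j, hij, rfl⟩ _ ⟨hb, k, l, hkl, rfl⟩
  rcases lt_trichotomy (i : ℕ) k with h | h | h
  · exact (no_two_simple n S hup hab i j k l hij hkl h ha hb).elim
  · have e1 : i = k := Fin.ext h
    have e2 : j = l := Fin.ext (by omega)
    rw [e1, e2]
  · exact (no_two_simple n S hup hab k l i j hkl hij h hb ha).elim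
end

section
/- Every abelian upper set S of the root poset of type D_n (n ≥ 3) contains at most one simple root, i.e. |S ∩ Π| ≤ 1. -/
theorem stdD_sub_mem (n : ℕ) (k : ℕ) : ∀ i j : Fin n, (i : ℕ) + k = (j : ℕ) →
    stdD n i - stdD n j ∈ AddSubmonoid.closure (simpleD n) := by
  induction k with
  | zero =>
    intro i j h
    have : i = j := Fin.ext (by omega)
    subst this
    simp
  | succ k ih =>
    intro i j h
    have hj := j.isLt
    have h1 := ih i ⟨i + k, by omega⟩ rfl
    have h2 : stdD n ⟨i + k, by omega⟩ - stdD n j ∈ AddSubmonoid.closure (simpleD n) :=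
      AddSubmonoid.subset_closure (Or.inl ⟨_, _, by simp; omega, rfl⟩)
    have h3 := add_mem h1 h2
    rwa [sub_add_sub_cancel] at h3

/-- If `e i - e j` lies in an upper set, so does `e i' - e j'` for `i' ≤ i`, `j ≤ j'`. -/
theorem upper_sub (n : ℕ) (S : Set (Fin n → ℤ)) (hup : isUpperD n S) (i j i' j' : Fin n)
    (h : stdD n i - stdD n j ∈ S) (hij : i < j) (hi : i' ≤ i) (hj : j ≤ j') :
    stdD n i' - stdD n j' ∈ S := by
  refine hup.2 _ h _ (Or.inl ⟨_, _, by omega, rfl⟩) ?_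
  have h1 := stdD_sub_mem n (i - i') i' i (by omega)
  have h2 := stdD_sub_mem n (j' - j) j j' (by omega)
  have h3 := add_mem h1 h2
  unfold rootLeD
  convert h3 using 1
  abel

theorem no_AA (n : ℕ) (S : Set (Fin n → ℤ)) (hup : isUpperD n S)
    (hab : ∀ a ∈ S, ∀ b ∈ S, a + b ∉ posD n) (i j k l : Fin n)
    (hij : (i : ℕ) + 1 = j) (hkl : (k : ℕ) + 1 = l)
    (h : stdD n i - stdD n j ∈ S) (h' : stdD n k - stdD n l ∈ S) (hik : i < k) : False := by
  have h1 := upper_sub n S hup i j i k h (by omega) le_rfl (by omega)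
  refine hab _ h1 _ h' (Or.inl ⟨i, l, by omega, ?_⟩)
  abel

theorem no_AB (n : ℕ) (hn : 3 ≤ n) (S : Set (Fin n → ℤ)) (hup : isUpperD n S)
    (hab : ∀ a ∈ S, ∀ b ∈ S, a + b ∉ posD n) (i j k l : Fin n)
    (hij : (i : ℕ) + 1 = j) (hkl : (k : ℕ) + 1 = l) (hl : (l : ℕ) + 1 = n)
    (h : stdD n i - stdD n j ∈ S) (h' : stdD n k + stdD n l ∈ S) : False := by
  have hj := j.isLt
  by_cases hik : i < k
  · have h1 := upper_sub n S hup i j i k h (by omega) le_rfl (by omega)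
    refine hab _ h1 _ h' (Or.inr ⟨i, l, by omega, ?_⟩)
    abel
  · have e1 : i = k := by omega
    have e2 : j = l := by omega
    subst e1 e2
    have hlt : (i : ℕ) - 1 < n := by omega
    have h1 := upper_sub n S hup i j ⟨i - 1, hlt⟩ j h (by omega)
      (by rw [Fin.le_def]; simp) le_rfl
    refine hab _ h1 _ h' (Or.inr ⟨⟨i - 1, hlt⟩, i, by rw [Fin.lt_def]; simp; omega, ?_⟩)
    abel

theorem stmt_12 (n : ℕ) (hn : 3 ≤ n) (S : Set (Fin n → ℤ)) (hup : isUpperD n S)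
    (hab : ∀ a ∈ S, ∀ b ∈ S, a + b ∉ posD n) :
    (S ∩ simpleD n).ncard ≤ 1 := by
  have hs : (S ∩ simpleD n).Subsingleton := by
    rintro x ⟨hx, ⟨i, j, hij, rfl⟩ | ⟨i, j, hij, hj, rfl⟩⟩ y
      ⟨hy, ⟨k, l, hkl, rfl⟩ | ⟨k, l, hkl, hl, rfl⟩⟩
    · rcases lt_trichotomy i k with h | h | h
      · exact (no_AA n S hup hab i j k l hij hkl hx hy h).elim
      · subst h
        have : j = l := by omega
        rw [this]
      · exact (no_AA n S hup hab k l i j hkl hij hy hx h).elim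
    · exact (no_AB n hn S hup hab i j k l hij hkl hl hx hy).elim
    · exact (no_AB n hn S hup hab k l i j hkl hij hj hy hx).elim
    · have e1 : i = k := by omega
      have e2 : j = l := by omega
      rw [e1, e2]
  exact (Set.ncard_le_one hs.finite).2 fun a ha b hb => hs ha hb
end

section
/- For n ≥ 1, the number of abelian upper sets S of the root poset of type A_n with |S ∩ Π| = j equals: 2^n − n if j = 0; n if j = 1; and 0 if j > 1. -/
/-- The root with natural-number indices. -/
def rtN (n i j : ℕ) : Fin (n + 1) → ℤ :=
  fun t => (if (t : ℕ) = i then 1 else 0) - (if (t : ℕ) = j then 1 else 0)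

theorem rtN_eq (n : ℕ) (i j : Fin (n + 1)) : stdA n i - stdA n j = rtN n i j := by
  funext t
  simp [stdA, rtN, Pi.single_apply, Fin.ext_iff]

theorem mem_posA (n : ℕ) (x : Fin (n + 1) → ℤ) :
    x ∈ posA n ↔ ∃ i j : ℕ, i < j ∧ j ≤ n ∧ x = rtN n i j := by
  constructor
  · rintro ⟨i, j, h, rfl⟩
    exact ⟨i, j, h, by omega, rtN_eq n i j⟩
  · rintro ⟨i, j, h, h2, rfl⟩
    exact ⟨⟨i, by omega⟩, ⟨j, by omega⟩, by simpa using h, by rw [rtN_eq]⟩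

theorem mem_simpleA (n : ℕ) (x : Fin (n + 1) → ℤ) :
    x ∈ simpleA n ↔ ∃ i : ℕ, i < n ∧ x = rtN n i (i + 1) := by
  constructor
  · rintro ⟨i, j, h, rfl⟩
    exact ⟨i, by omega, by rw [rtN_eq, h]⟩
  · rintro ⟨i, h, rfl⟩
    exact ⟨⟨i, by omega⟩, ⟨i + 1, by omega⟩, rfl, by rw [rtN_eq]⟩

theorem rtN_inj {n i j k l : ℕ} (h : i < j) (hj : j ≤ n) (h' : k < l) (hl : l ≤ n)
    (he : rtN n i j = rtN n k l) : i = k ∧ j = l := by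
  have h1 := congrFun he ⟨i, by omega⟩
  have h2 := congrFun he ⟨j, by omega⟩
  simp only [rtN] at h1 h2
  split_ifs at h1 h2 <;> omega

theorem rtN_add {n i j k l p q : ℕ} (h : i < j) (hj : j ≤ n) (h' : k < l) (hl : l ≤ n)
    (hpq : p < q) (he : rtN n i j + rtN n k l = rtN n p q) : j = k ∨ l = i := by
  have h1 := congrFun he ⟨i, by omega⟩
  have h2 := congrFun he ⟨k, by omega⟩
  by_contra hc
  push Not at hc
  have hij : i ≠ j := by omega
  have hkl : k ≠ l := by omega
  have hil : i ≠ l := by omega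
  have hkj : k ≠ j := by omega
  simp only [rtN, Pi.add_apply, hij, hkl, hil, hkj, if_true, if_false] at h1 h2
  by_cases hik : i = k
  · subst hik
    simp only [if_true] at h1
    split_ifs at h1 <;> omega
  · simp only [hik, Ne.symm hik, if_false] at h1 h2
    have e1 : i = p := by
      by_contra hne
      simp only [hne, if_false] at h1
      split_ifs at h1
      all_goals omega
    have e2 : k = p := by
      by_contra hne
      simp only [hne, if_false] at h2
      split_ifs at h2
      all_goals omega
    omega

theorem rtN_trans (n i j k : ℕ) : rtN n i j + rtN n j k = rtN n i k := by
  funext t; simp [rtN]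

theorem rtN_closure (n i d : ℕ) (h : i + d ≤ n) :
    rtN n i (i + d) ∈ AddSubmonoid.closure (simpleA n) := by
  induction d with
  | zero =>
    have : rtN n i (i + 0) = 0 := by funext t; simp [rtN]
    rw [this]; exact zero_mem _
  | succ d ih =>
    rw [← rtN_trans n i (i + d)]
    exact add_mem (ih (by omega)) (AddSubmonoid.subset_closure
      ((mem_simpleA _ _).2 ⟨i + d, by omega, rfl⟩))

def psum (n m : ℕ) (x : Fin (n + 1) → ℤ) : ℤ := ∑ t : Fin (n + 1), if (t : ℕ) ≤ m then x t else 0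

theorem psum_rtN (n m i j : ℕ) (hi : i ≤ n) (hj : j ≤ n) :
    psum n m (rtN n i j) = (if i ≤ m then 1 else 0) - (if j ≤ m then 1 else 0) := by
  have key : ∀ a ≤ n, (∑ t : Fin (n + 1), if (t : ℕ) ≤ m then (if (t : ℕ) = a then (1 : ℤ) else 0) else 0)
      = if a ≤ m then 1 else 0 := by
    intro a ha
    rw [Finset.sum_eq_single (⟨a, by omega⟩ : Fin (n + 1))]
    · simp
    · intro b _ hb
      have : (b : ℕ) ≠ a := fun h => hb (Fin.ext h)
      simp [this]
    · simp
  rw [← key i hi, ← key j hj, ← Finset.sum_sub_distrib, psum]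
  apply Finset.sum_congr rfl
  intro t _
  simp only [rtN]
  split_ifs <;> rfl

theorem psum_add (n m : ℕ) (x y : Fin (n + 1) → ℤ) :
    psum n m (x + y) = psum n m x + psum n m y := by
  simp only [psum, ← Finset.sum_add_distrib]
  apply Finset.sum_congr rfl
  intro t _
  split_ifs <;> simp

theorem psum_nonneg (n m : ℕ) (x : Fin (n + 1) → ℤ)
    (hx : x ∈ AddSubmonoid.closure (simpleA n)) : 0 ≤ psum n m x := by
  induction hx using AddSubmonoid.closure_induction with
  | mem x hx =>
    obtain ⟨i, hi, rfl⟩ := (mem_simpleA _ _).1 hx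
    rw [psum_rtN _ _ _ _ (by omega) (by omega)]
    split_ifs <;> omega
  | zero => simp [psum]
  | add x y _ _ h1 h2 => rw [psum_add]; omega

theorem rootLe_iff {n i j k l : ℕ} (h : i < j) (hj : j ≤ n) (h' : k < l) (hl : l ≤ n) :
    rootLeA n (rtN n i j) (rtN n k l) ↔ k ≤ i ∧ j ≤ l := by
  constructor
  · intro H
    have key : ∀ m, psum n m (rtN n i j) ≤ psum n m (rtN n k l) := by
      intro m
      have h1 := psum_nonneg n m _ H
      have h2 := psum_add n m (rtN n k l - rtN n i j) (rtN n i j)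
      rw [sub_add_cancel] at h2
      omega
    have h1 := key i
    have h2 := key l
    rw [psum_rtN _ _ _ _ (by omega) (by omega), psum_rtN _ _ _ _ (by omega) (by omega)] at h1 h2
    split_ifs at h1 h2 <;> omega
  · rintro ⟨h1, h2⟩
    have e : rtN n k l - rtN n i j = rtN n k i + rtN n j l := by
      funext t; simp [rtN]; ring
    unfold rootLeA
    rw [e]
    obtain ⟨d, rfl⟩ := Nat.exists_eq_add_of_le h1
    obtain ⟨d', rfl⟩ := Nat.exists_eq_add_of_le h2
    exact add_mem (rtN_closure _ _ _ (by omega)) (rtN_closure _ _ _ (by omega))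

/-- Lists of row lengths of diagrams with largest hook at most `n`. -/
def wl : ℕ → Finset (List ℕ)
  | 0 => {[]}
  | n + 1 => wl n ∪ (wl n).image (fun w => (n + 1 - w.length) :: w)

theorem mem_wl (n : ℕ) (w : List ℕ) :
    w ∈ wl n ↔ w.SortedGE ∧ (∀ x ∈ w, 0 < x) ∧ ∀ x ∈ w, x + w.length ≤ n + 1 := by
  induction n generalizing w with
  | zero =>
    cases w with
    | nil => simp [wl, List.sortedGE_iff_pairwise]
    | cons x t =>
      simp only [wl, Finset.mem_singleton, reduceCtorEq, false_iff]
      rintro ⟨_, h1, h2⟩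
      have := h1 x (by simp)
      have := h2 x (by simp)
      simp at this
      omega
  | succ n ih =>
    simp only [wl, Finset.mem_union, Finset.mem_image]
    constructor
    · rintro (h | ⟨t, h, rfl⟩)
      · obtain ⟨h1, h2, h3⟩ := (ih w).1 h
        exact ⟨h1, h2, fun x hx => by have := h3 x hx; omega⟩
      · obtain ⟨h1, h2, h3⟩ := (ih t).1 h
        have hlen : t.length ≤ n := by
          cases t with
          | nil => simp
          | cons y s =>
            have := h2 y (by simp)
            have := h3 y (by simp)
            omega
        refine ⟨?_, ?_, ?_⟩
        · rw [List.sortedGE_iff_pairwise] at h1 ⊢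
          rw [List.pairwise_cons]
          exact ⟨fun y hy => by have := h3 y hy; show y ≤ _; omega, h1⟩
        · intro x hx
          rcases List.mem_cons.1 hx with rfl | hx
          · omega
          · exact h2 x hx
        · intro x hx
          rw [List.length_cons]
          rcases List.mem_cons.1 hx with rfl | hx
          · omega
          · have := h3 x hx; omega
    · rintro ⟨h1, h2, h3⟩
      cases w with
      | nil => left; rw [ih]; simp_all
      | cons x t =>
        rw [List.sortedGE_iff_pairwise, List.pairwise_cons] at h1
        obtain ⟨h0, h1⟩ := h1
        have hx := h3 x (by simp)
        rw [List.length_cons] at hx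
        by_cases hc : x + (t.length + 1) ≤ n + 1
        · left
          rw [ih]
          refine ⟨by rw [List.sortedGE_iff_pairwise, List.pairwise_cons]; exact ⟨h0, h1⟩, h2, ?_⟩
          intro y hy
          rw [List.length_cons]
          rcases List.mem_cons.1 hy with rfl | hy
          · exact hc
          · have : y ≤ x := h0 y hy
            omega
        · right
          refine ⟨t, (ih t).2 ⟨List.sortedGE_iff_pairwise.2 h1,
            fun y hy => h2 y (List.mem_cons_of_mem _ hy), fun y hy => ?_⟩, ?_⟩
          · have : y ≤ x := h0 y hy
            omega
          · congr 1; omega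

theorem card_wl (n : ℕ) : (wl n).card = 2 ^ n := by
  induction n with
  | zero => simp [wl]
  | succ n ih =>
    rw [wl, Finset.card_union_of_disjoint, Finset.card_image_of_injective, ih]
    · ring
    · intro a b h
      simp at h
      exact h.2
    · rw [Finset.disjoint_left]
      intro w hw h
      obtain ⟨t, ht, rfl⟩ := Finset.mem_image.1 h
      have := ((mem_wl _ _).1 hw).2.2 (n + 1 - t.length) (by simp)
      rw [List.length_cons] at this
      omega

/-- Diagrams with largest hook at most `n`. -/
def ydS (n : ℕ) : Set YoungDiagram := {μ | ∀ p ∈ μ, ∀ q ∈ μ, p.1 + q.2 < n}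

theorem ydS_iff (n : ℕ) (μ : YoungDiagram) : μ ∈ ydS n ↔ μ.rowLens ∈ wl n := by
  rw [mem_wl]
  constructor
  · intro h
    refine ⟨μ.rowLens_sorted, fun x hx => μ.pos_of_mem_rowLens x hx, fun x hx => ?_⟩
    have hp := μ.pos_of_mem_rowLens x hx
    rw [YoungDiagram.length_rowLens]
    simp only [YoungDiagram.rowLens, List.mem_map, List.mem_range] at hx
    obtain ⟨i, hi, rfl⟩ := hx
    have h1 : (i, μ.rowLen i - 1) ∈ μ := YoungDiagram.mem_iff_lt_rowLen.2 (by omega)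
    have h2 : (μ.colLen 0 - 1, 0) ∈ μ := YoungDiagram.mem_iff_lt_colLen.2 (by omega)
    have := h _ h2 _ h1
    simp at this
    omega
  · rintro ⟨-, -, h⟩ ⟨a, b⟩ hp ⟨c, d⟩ hq
    have h1 : (a, 0) ∈ μ := μ.up_left_mem le_rfl (Nat.zero_le _) hp
    have h2 : (c, 0) ∈ μ := μ.up_left_mem le_rfl (Nat.zero_le _) hq
    rw [YoungDiagram.mem_iff_lt_colLen] at h1 h2
    rw [YoungDiagram.mem_iff_lt_rowLen] at hq
    have := h (μ.rowLen c) (by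
      simp only [YoungDiagram.rowLens, List.mem_map, List.mem_range]
      exact ⟨c, h2, rfl⟩)
    rw [YoungDiagram.length_rowLens] at this
    show a + d < n
    omega

theorem ydS_image (n : ℕ) : YoungDiagram.rowLens '' ydS n = (wl n : Set (List ℕ)) := by
  ext w
  constructor
  · rintro ⟨μ, h, rfl⟩
    exact (ydS_iff _ _).1 h
  · intro h
    have hw := (mem_wl n w).1 h
    have e := YoungDiagram.rowLens_ofRowLens_eq_self (hw := hw.1) hw.2.1
    exact ⟨YoungDiagram.ofRowLens w hw.1, (ydS_iff _ _).2 (by rw [e]; exact h), e⟩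

theorem rowLens_inj : Function.Injective YoungDiagram.rowLens := by
  intro a b h
  apply YoungDiagram.equivListRowLens.injective
  exact Subtype.ext h

theorem ncard_ydS (n : ℕ) : (ydS n).ncard = 2 ^ n := by
  rw [← Set.ncard_image_of_injective _ rowLens_inj, ydS_image, Set.ncard_coe_finset, card_wl]

theorem finite_ydS (n : ℕ) : (ydS n).Finite := by
  apply Set.finite_of_ncard_pos
  rw [ncard_ydS]; positivity

/-- Rectangles. -/
def rectY (n i : ℕ) : YoungDiagram where
  cells := Finset.range (i + 1) ×ˢ Finset.range (n - i)
  isLowerSet := by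
    rintro ⟨a, b⟩ ⟨c, d⟩ h h'
    have h1 : c ≤ a := h.1
    have h2 : d ≤ b := h.2
    simp only [Finset.coe_product, Set.mem_prod, Finset.coe_range, Set.mem_Iio] at h' ⊢
    omega

theorem mem_rectY (n i a b : ℕ) : (a, b) ∈ rectY n i ↔ a ≤ i ∧ b < n - i := by
  rw [← YoungDiagram.mem_cells]
  simp only [rectY, Finset.mem_product, Finset.mem_range]
  omega

/-- Diagrams meeting the outer diagonal. -/
def ydD (n : ℕ) : Set YoungDiagram := {μ | μ ∈ ydS n ∧ ∃ i < n, (i, n - 1 - i) ∈ μ}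

theorem ydD_image (n : ℕ) : ydD n = rectY n '' (Finset.range n : Set ℕ) := by
  ext μ
  constructor
  · rintro ⟨h, i, hi, hm⟩
    refine ⟨i, by simpa using hi, ?_⟩
    apply SetLike.ext
    rintro ⟨a, b⟩
    rw [mem_rectY]
    constructor
    · rintro ⟨h1, h2⟩
      exact μ.up_left_mem h1 (by omega) hm
    · intro hab
      have h1 := h _ hab _ hm
      have h2 := h _ hm _ hab
      simp only at h1 h2
      omega
  · rintro ⟨i, hi, rfl⟩
    have hi : i < n := by simpa using hi
    refine ⟨?_, i, hi, ?_⟩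
    · rintro ⟨a, b⟩ h1 ⟨c, d⟩ h2
      rw [mem_rectY] at h1 h2
      show a + d < n
      omega
    · rw [mem_rectY]; omega

theorem ncard_ydD (n : ℕ) : (ydD n).ncard = n := by
  rw [ydD_image, Set.InjOn.ncard_image, Set.ncard_coe_finset, Finset.card_range]
  intro i hi k hk h
  have hi : i < n := by simpa using hi
  have hk : k < n := by simpa using hk
  have h1 : (i, 0) ∈ rectY n k := by rw [← h, mem_rectY]; omega
  have h2 : (k, 0) ∈ rectY n i := by rw [h, mem_rectY]; omega
  rw [mem_rectY] at h1 h2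
  omega

/-- The root set of a diagram. -/
def psiY (n : ℕ) (μ : YoungDiagram) : Set (Fin (n + 1) → ℤ) :=
  {x | ∃ i j, i < j ∧ j ≤ n ∧ (i, n - j) ∈ μ ∧ x = rtN n i j}

theorem mem_psiY {n i j : ℕ} (μ : YoungDiagram) (h : i < j) (hj : j ≤ n) :
    rtN n i j ∈ psiY n μ ↔ (i, n - j) ∈ μ := by
  constructor
  · rintro ⟨k, l, h1, h2, h3, h4⟩
    obtain ⟨rfl, rfl⟩ := rtN_inj h hj h1 h2 h4
    exact h3
  · intro hm
    exact ⟨i, j, h, hj, hm, rfl⟩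

/-- Abelian upper sets. -/
def abU (n : ℕ) : Set (Set (Fin (n + 1) → ℤ)) :=
  {S | isUpperA n S ∧ ∀ a ∈ S, ∀ b ∈ S, a + b ∉ posA n}

theorem psiY_mem (n : ℕ) (μ : YoungDiagram) (h : μ ∈ ydS n) : psiY n μ ∈ abU n := by
  refine ⟨⟨?_, ?_⟩, ?_⟩
  · rintro x ⟨i, j, h1, h2, -, rfl⟩
    exact (mem_posA _ _).2 ⟨i, j, h1, h2, rfl⟩
  · rintro x ⟨i, j, h1, h2, h3, rfl⟩ b hb hle
    obtain ⟨k, l, h4, h5, rfl⟩ := (mem_posA _ _).1 hb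
    rw [rootLe_iff h1 h2 h4 h5] at hle
    rw [mem_psiY _ h4 h5]
    exact μ.up_left_mem hle.1 (by omega) h3
  · rintro x ⟨i, j, h1, h2, h3, rfl⟩ y ⟨k, l, h4, h5, h6, rfl⟩ hs
    obtain ⟨p, q, h7, h8, h9⟩ := (mem_posA _ _).1 hs
    have e1 := h _ h3 _ h6
    have e2 := h _ h6 _ h3
    simp only at e1 e2
    rcases rtN_add h1 h2 h4 h5 h7 h9 with e | e <;> omega

theorem psiY_injOn (n : ℕ) : Set.InjOn (psiY n) (ydS n) := by
  have key : ∀ μ ∈ ydS n, ∀ ν, psiY n μ = psiY n ν → μ ≤ ν := by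
    rintro μ hμ ν h ⟨a, b⟩ hab
    have hab : (a, b) ∈ μ := hab
    have h1 := hμ _ hab _ hab
    simp only at h1
    have e : n - (n - b) = b := by omega
    have h2 := (mem_psiY (n := n) (i := a) (j := n - b) μ (by omega) (by omega)).2 (by rwa [e])
    rw [h, mem_psiY _ (by omega) (by omega), e] at h2
    exact h2
  intro μ hμ ν hν h
  exact le_antisymm (key μ hμ ν h) (key ν hν μ h.symm)

theorem psiY_image (n : ℕ) : psiY n '' ydS n = abU n := by
  classical
  ext S
  constructor
  · rintro ⟨μ, h, rfl⟩
    exact psiY_mem n μ h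
  rintro ⟨⟨hpos, hup⟩, hab⟩
  let c : Finset (ℕ × ℕ) := (Finset.range n ×ˢ Finset.range n).filter
    (fun p => p.1 + p.2 < n ∧ rtN n p.1 (n - p.2) ∈ S)
  have hc : ∀ a b, (a, b) ∈ c ↔ a + b < n ∧ rtN n a (n - b) ∈ S := by
    intro a b
    simp only [c, Finset.mem_filter, Finset.mem_product, Finset.mem_range]
    constructor
    · exact fun h => h.2
    · exact fun h => ⟨by omega, h⟩
  have hlow : ∀ i j k l, i < j → j ≤ n → k ≤ i → j ≤ l → l ≤ n → rtN n i j ∈ S →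
      rtN n k l ∈ S := by
    intro i j k l h1 h2 h3 h4 h5 h
    exact hup _ h _ ((mem_posA _ _).2 ⟨k, l, by omega, h5, rfl⟩)
      ((rootLe_iff h1 h2 (by omega) h5).2 ⟨h3, h4⟩)
  let μ : YoungDiagram := ⟨c, by
    rintro ⟨a, b⟩ ⟨a', b'⟩ h h'
    have h1 : a' ≤ a := h.1
    have h2 : b' ≤ b := h.2
    rw [Finset.mem_coe, hc] at h' ⊢
    exact ⟨by omega, hlow a (n - b) _ _ (by omega) (by omega) h1 (by omega) (by omega) h'.2⟩⟩
  have hμ : ∀ a b, (a, b) ∈ μ ↔ a + b < n ∧ rtN n a (n - b) ∈ S := fun a b => hc a b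
  refine ⟨μ, ?_, ?_⟩
  · rintro ⟨a, b⟩ h1 ⟨a', b'⟩ h2
    rw [hμ] at h1 h2
    show a + b' < n
    by_contra hcon
    have h3 : rtN n (n - b') (n - b) ∈ S :=
      hlow a (n - b) _ _ (by omega) (by omega) (by omega) le_rfl (by omega) h1.2
    apply hab _ h2.2 _ h3
    rw [rtN_trans]
    obtain ⟨k, l, h4, h5, h6⟩ := (mem_posA _ _).1 (hpos h3)
    have : n - b' < n - b := by omega
    exact (mem_posA _ _).2 ⟨_, _, by omega, by omega, rfl⟩
  · ext x
    constructor
    · rintro ⟨i, j, h1, h2, h3, rfl⟩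
      have := ((hμ _ _).1 h3).2
      rwa [show n - (n - j) = j by omega] at this
    · intro hx
      obtain ⟨i, j, h1, h2, rfl⟩ := (mem_posA _ _).1 (hpos hx)
      rw [mem_psiY _ h1 h2, hμ, show n - (n - j) = j by omega]
      exact ⟨by omega, hx⟩

theorem ncard_simple (n : ℕ) (μ : YoungDiagram) (h : μ ∈ ydS n) :
    (μ ∈ ydD n → (psiY n μ ∩ simpleA n).ncard = 1) ∧
    (μ ∉ ydD n → (psiY n μ ∩ simpleA n).ncard = 0) := by
  have hs : ∀ i < n, rtN n i (i + 1) ∈ psiY n μ → (i, n - 1 - i) ∈ μ := by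
    intro i hi hm
    rw [mem_psiY _ (by omega) (by omega)] at hm
    rwa [show n - 1 - i = n - (i + 1) by omega]
  constructor
  · rintro ⟨-, i, hi, hm⟩
    rw [Set.ncard_eq_one]
    refine ⟨rtN n i (i + 1), ?_⟩
    ext x
    rw [Set.mem_singleton_iff]
    constructor
    · rintro ⟨hx, hx'⟩
      obtain ⟨k, hk, rfl⟩ := (mem_simpleA _ _).1 hx'
      have hk' := hs k hk hx
      have e1 := h _ hm _ hk'
      have e2 := h _ hk' _ hm
      simp only at e1 e2
      rw [show k = i by omega]
    · rintro rfl
      refine ⟨?_, (mem_simpleA _ _).2 ⟨i, hi, rfl⟩⟩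
      rw [mem_psiY _ (by omega) (by omega)]
      rwa [show n - (i + 1) = n - 1 - i by omega]
  · intro hn
    have : psiY n μ ∩ simpleA n = ∅ := by
      rw [Set.eq_empty_iff_forall_notMem]
      rintro x ⟨hx, hx'⟩
      obtain ⟨k, hk, rfl⟩ := (mem_simpleA _ _).1 hx'
      exact hn ⟨h, k, hk, hs k hk hx⟩
    rw [this, Set.ncard_empty]

theorem stmt_13 (n j : ℕ) (hn : 1 ≤ n) :
    Nat.card {S : Set (Fin (n + 1) → ℤ) //
        isUpperA n S ∧ (∀ a ∈ S, ∀ b ∈ S, a + b ∉ posA n) ∧ (S ∩ simpleA n).ncard = j} =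
      if j = 0 then 2 ^ n - n else if j = 1 then n else 0 := by
  have e : {S : Set (Fin (n + 1) → ℤ) |
        isUpperA n S ∧ (∀ a ∈ S, ∀ b ∈ S, a + b ∉ posA n) ∧ (S ∩ simpleA n).ncard = j}
      = psiY n '' {μ | μ ∈ ydS n ∧ (psiY n μ ∩ simpleA n).ncard = j} := by
    ext S
    constructor
    · rintro ⟨h1, h2, h3⟩
      have hS : S ∈ abU n := ⟨h1, h2⟩
      rw [← psiY_image] at hS
      obtain ⟨μ, hμ, rfl⟩ := hS
      exact ⟨μ, ⟨hμ, h3⟩, rfl⟩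
    · rintro ⟨μ, ⟨hμ, h3⟩, rfl⟩
      have := psiY_mem n μ hμ
      exact ⟨this.1, this.2, h3⟩
  have e2 : Nat.card {S : Set (Fin (n + 1) → ℤ) //
        isUpperA n S ∧ (∀ a ∈ S, ∀ b ∈ S, a + b ∉ posA n) ∧ (S ∩ simpleA n).ncard = j}
      = {μ | μ ∈ ydS n ∧ (psiY n μ ∩ simpleA n).ncard = j}.ncard := by
    rw [← Set.InjOn.ncard_image ((psiY_injOn n).mono (fun μ h => h.1)), ← e]
    exact Nat.card_coe_set_eq _
  rw [e2]
  have hsub : ydD n ⊆ ydS n := fun μ h => h.1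
  split_ifs with h0 h1
  · subst h0
    have : {μ | μ ∈ ydS n ∧ (psiY n μ ∩ simpleA n).ncard = 0} = ydS n \ ydD n := by
      ext μ
      constructor
      · rintro ⟨h, h'⟩
        refine ⟨h, fun hd => ?_⟩
        have := (ncard_simple n μ h).1 hd
        omega
      · rintro ⟨h, h'⟩
        exact ⟨h, (ncard_simple n μ h).2 h'⟩
    rw [this, Set.ncard_sdiff hsub ((finite_ydS n).subset hsub), ncard_ydS, ncard_ydD]
  · subst h1
    have : {μ | μ ∈ ydS n ∧ (psiY n μ ∩ simpleA n).ncard = 1} = ydD n := by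
      ext μ
      constructor
      · rintro ⟨h, h'⟩
        by_contra hd
        have := (ncard_simple n μ h).2 hd
        omega
      · intro h
        exact ⟨h.1, (ncard_simple n μ h.1).1 h⟩
    rw [this, ncard_ydD]
  · have : {μ | μ ∈ ydS n ∧ (psiY n μ ∩ simpleA n).ncard = j} = ∅ := by
      rw [Set.eq_empty_iff_forall_notMem]
      rintro μ ⟨h, h'⟩
      by_cases hd : μ ∈ ydD n
      · have := (ncard_simple n μ h).1 hd
        omega
      · have := (ncard_simple n μ h).2 hd
        omega
    rw [this, Set.ncard_empty]
end

section
/- For n ≥ 1, the number of abelian upper sets S of the root poset of type B_n with |S ∩ Π| = j equals: 2^n − 1 if j = 0; 1 if j = 1; and 0 if j > 1. -/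
/-- The standard basis vector `e i` of `ℤ^n`. -/
def stdB (n : ℕ) (i : Fin n) : Fin n → ℤ := Pi.single i 1

/-- The set of positive roots of type `B_n`:
`e i - e j` and `e i + e j` for `i < j`, and `e i`. -/
def posB (n : ℕ) : Set (Fin n → ℤ) :=
  {x | (∃ i j : Fin n, i < j ∧ x = stdB n i - stdB n j) ∨
    (∃ i j : Fin n, i < j ∧ x = stdB n i + stdB n j) ∨ (∃ i : Fin n, x = stdB n i)}

/-- The set of simple roots of type `B_n`: `α i = e i - e (i+1)` for `i < n - 1`
together with the last simple root `e (n-1)`. -/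
def simpleB (n : ℕ) : Set (Fin n → ℤ) :=
  {x | (∃ i j : Fin n, (i : ℕ) + 1 = (j : ℕ) ∧ x = stdB n i - stdB n j) ∨
    (∃ i : Fin n, (i : ℕ) + 1 = n ∧ x = stdB n i)}

/-- The root poset order of type `B_n`. -/
def rootLeB (n : ℕ) (a b : Fin n → ℤ) : Prop :=
  b - a ∈ AddSubmonoid.closure (simpleB n)

/-- `S` is an upper set of the root poset of type `B_n`. -/
def isUpperB (n : ℕ) (S : Set (Fin n → ℤ)) : Prop :=
  S ⊆ posB n ∧ ∀ a ∈ S, ∀ b ∈ posB n, rootLeB n a b → b ∈ S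
/-- Upper sets of the staircase. -/
def stairB (m : ℕ) : Set (Set (ℕ × ℕ)) :=
  {U | (∀ i j, (i, j) ∈ U → i < j ∧ j < m) ∧
    (∀ i j i' j', (i, j) ∈ U → i' ≤ i → j' ≤ j → i' < j' → (i', j') ∈ U)}

def growB (m : ℕ) (U : Set (ℕ × ℕ)) : Set (ℕ × ℕ) :=
  {p | (p.1 = 0 ∧ 0 < p.2 ∧ p.2 < m) ∨ (∃ i j, (i, j) ∈ U ∧ p = (i + 1, j + 1))}

theorem mem_growB (m : ℕ) (U : Set (ℕ × ℕ)) (i j : ℕ) :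
    (i, j) ∈ growB m U ↔ (i = 0 ∧ 0 < j ∧ j < m) ∨ (∃ a b, (a, b) ∈ U ∧ i = a + 1 ∧ j = b + 1) := by
  simp [growB]

theorem growB_inj (m : ℕ) : Function.Injective (growB m) := by
  intro U V h
  ext ⟨i, j⟩
  have := Set.ext_iff.1 h (i + 1, j + 1)
  rw [mem_growB, mem_growB] at this
  simpa using this

theorem stairB_succ (m : ℕ) :
    stairB (m + 2) = stairB (m + 1) ∪ growB (m + 2) '' stairB (m + 1) := by
  ext U
  constructor
  · rintro ⟨h1, h2⟩
    by_cases h : (0, m + 1) ∈ U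
    · right
      refine ⟨{p | (p.1 + 1, p.2 + 1) ∈ U}, ⟨?_, ?_⟩, ?_⟩
      · intro i j hij
        have := h1 _ _ hij
        omega
      · intro i j i' j' hij a b c
        exact h2 _ _ _ _ hij (by omega) (by omega) (by omega)
      · ext ⟨i, j⟩
        rw [mem_growB]
        constructor
        · rintro (⟨rfl, a, b⟩ | ⟨a, b, hab, rfl, rfl⟩)
          · exact h2 _ _ _ _ h le_rfl (by omega) a
          · exact hab
        · intro hij
          have h3 := h1 _ _ hij
          rcases i with _ | i
          · left; omega
          · right
            rcases j with _ | j
            · omega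
            · exact ⟨i, j, hij, rfl, rfl⟩
    · left
      refine ⟨?_, h2⟩
      intro i j hij
      have h3 := h1 _ _ hij
      refine ⟨h3.1, ?_⟩
      by_contra hc
      exact h (h2 _ _ _ _ hij (by omega) (by omega) (by omega))
  · rintro (⟨h1, h2⟩ | ⟨V, ⟨h1, h2⟩, rfl⟩)
    · refine ⟨?_, h2⟩
      intro i j hij
      have := h1 _ _ hij
      omega
    · constructor
      · intro i j hij
        rw [mem_growB] at hij
        rcases hij with hij | ⟨a, b, hab, rfl, rfl⟩
        · omega
        · have := h1 _ _ hab
          omega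
      · intro i j i' j' hij hi hj hlt
        rw [mem_growB] at hij ⊢
        rcases hij with hij | ⟨a, b, hab, rfl, rfl⟩
        · left; omega
        · have h3 := h1 _ _ hab
          rcases i' with _ | i'
          · left; omega
          · right
            rcases j' with _ | j'
            · omega
            · exact ⟨i', j', h2 _ _ _ _ hab (by omega) (by omega) (by omega), rfl, rfl⟩

theorem stairB_card (m : ℕ) : (stairB (m + 1)).Finite ∧ (stairB (m + 1)).ncard = 2 ^ m := by
  induction m with
  | zero =>
    have : stairB 1 = {∅} := by
      ext U
      constructor
      · rintro ⟨h1, _⟩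
        rw [Set.mem_singleton_iff, Set.eq_empty_iff_forall_notMem]
        rintro ⟨i, j⟩ hij
        have := h1 _ _ hij
        omega
      · rintro rfl
        constructor <;> simp
    rw [zero_add, this]
    simp
  | succ m ih =>
    rw [stairB_succ]
    refine ⟨ih.1.union (ih.1.image _), ?_⟩
    rw [Set.ncard_union_eq _ ih.1 (ih.1.image _), Set.ncard_image_of_injective _ (growB_inj _), ih.2]
    · ring
    · rw [Set.disjoint_left]
      rintro U ⟨h1, _⟩ ⟨V, _, rfl⟩
      have := h1 0 (m + 1) (by rw [mem_growB]; left; omega)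
      omega

theorem stdB_apply (n : ℕ) (i k : Fin n) : stdB n i k = if (k : ℕ) = i then 1 else 0 := by
  simp [stdB, Pi.single_apply, Fin.ext_iff]

/-- Partial sums. -/
def psB (n : ℕ) (k : Fin n) : (Fin n → ℤ) →+ ℤ where
  toFun x := ∑ i ∈ Finset.univ.filter (fun i => i ≤ k), x i
  map_zero' := by simp
  map_add' x y := by simp [Finset.sum_add_distrib]

theorem psB_std (n : ℕ) (i k : Fin n) : psB n k (stdB n i) = if (i : ℕ) ≤ k then 1 else 0 := by
  change ∑ l ∈ Finset.univ.filter (fun l => l ≤ k), stdB n i l = _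
  simp only [stdB, Finset.sum_pi_single', Finset.mem_filter, Finset.mem_univ, true_and, Fin.le_def]

theorem psB_mono (n : ℕ) (a b : Fin n → ℤ) (h : rootLeB n a b) (k : Fin n) :
    psB n k a ≤ psB n k b := by
  have : 0 ≤ psB n k (b - a) := by
    unfold rootLeB at h
    generalize b - a = c at h
    induction h using AddSubmonoid.closure_induction with
    | mem x hx =>
      rcases hx with ⟨i, j, hij, rfl⟩ | ⟨i, hi, rfl⟩
      · rw [map_sub, psB_std, psB_std]; split_ifs <;> omega
      · rw [psB_std]; split_ifs <;> omega
    | zero => simp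
    | add x y _ _ hx hy => rw [map_add]; omega
  rw [map_sub] at this
  omega

theorem clos_std (n : ℕ) (d : ℕ) : ∀ i : Fin n, (i : ℕ) + 1 + d = n →
    stdB n i ∈ AddSubmonoid.closure (simpleB n) := by
  induction d with
  | zero => 
    intro i hi
    exact AddSubmonoid.subset_closure (Or.inr ⟨i, by omega, rfl⟩)
  | succ d ih =>
    intro i hi
    have h1 := ih ⟨i + 1, by omega⟩ (by simp; omega)
    have h2 : stdB n i - stdB n ⟨i + 1, by omega⟩ ∈ AddSubmonoid.closure (simpleB n) :=
      AddSubmonoid.subset_closure (Or.inl ⟨i, _, rfl, rfl⟩)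
    simpa using add_mem h2 h1

theorem clos_std' (n : ℕ) (i : Fin n) : stdB n i ∈ AddSubmonoid.closure (simpleB n) :=
  clos_std n (n - (i + 1)) i (by omega)

theorem clos_sub (n : ℕ) (d : ℕ) : ∀ i j : Fin n, (i : ℕ) + d = j →
    stdB n i - stdB n j ∈ AddSubmonoid.closure (simpleB n) := by
  induction d with
  | zero => 
    intro i j hi
    have : i = j := Fin.ext (by omega)
    subst this
    simp
  | succ d ih =>
    intro i j hi
    have h1 := ih ⟨i + 1, by omega⟩ j (by simp; omega)
    have h2 : stdB n i - stdB n ⟨i + 1, by omega⟩ ∈ AddSubmonoid.closure (simpleB n) :=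
      AddSubmonoid.subset_closure (Or.inl ⟨i, _, rfl, rfl⟩)
    simpa using add_mem h2 h1

theorem clos_sub' (n : ℕ) (i j : Fin n) (h : (i : ℕ) ≤ j) :
    stdB n i - stdB n j ∈ AddSubmonoid.closure (simpleB n) :=
  clos_sub n (j - i) i j (by omega)

theorem le_pp (n : ℕ) (i j i' j' : Fin n) (hi : (i' : ℕ) ≤ i) (hj : (j' : ℕ) ≤ j) :
    rootLeB n (stdB n i + stdB n j) (stdB n i' + stdB n j') := by
  have := add_mem (clos_sub' n i' i hi) (clos_sub' n j' j hj)
  unfold rootLeB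
  convert this using 1
  abel

theorem le_ss (n : ℕ) (i i' : Fin n) (hi : (i' : ℕ) ≤ i) :
    rootLeB n (stdB n i) (stdB n i') := clos_sub' n i' i hi

theorem le_sp (n : ℕ) (i j : Fin n) : rootLeB n (stdB n i) (stdB n i + stdB n j) := by
  unfold rootLeB
  simpa using clos_std' n j

theorem le_ms (n : ℕ) (i j : Fin n) : rootLeB n (stdB n i - stdB n j) (stdB n i) := by
  unfold rootLeB
  simpa using clos_std' n j

theorem le_mm (n : ℕ) (i j j' : Fin n) (h : (j : ℕ) ≤ j') :
    rootLeB n (stdB n i - stdB n j) (stdB n i - stdB n j') := by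
  unfold rootLeB
  simpa using clos_sub' n j j' h

def fA (n : ℕ) (U : Set (ℕ × ℕ)) : Set (Fin n → ℤ) :=
  {x | ∃ i j : Fin n, i < j ∧ ((i : ℕ), (j : ℕ)) ∈ U ∧ x = stdB n i + stdB n j}

def fB (n : ℕ) (U : Set (ℕ × ℕ)) : Set (Fin n → ℤ) :=
  {x | (∃ i j : Fin n, i < j ∧ ((i : ℕ) = 0 ∨ ((i : ℕ), (j : ℕ)) ∈ U) ∧ x = stdB n i + stdB n j) ∨
    (∃ i : Fin n, (i : ℕ) = 0 ∧ x = stdB n i) ∨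
    (∃ i j : Fin n, i < j ∧ (i : ℕ) = 0 ∧ (0, (j : ℕ)) ∉ U ∧ x = stdB n i - stdB n j)}

theorem pp_inj (n : ℕ) (i j i' j' : Fin n) (h : i < j) (h' : i' < j')
    (e : stdB n i + stdB n j = stdB n i' + stdB n j') : i = i' ∧ j = j' := by
  have h1 := congrFun e i
  have h2 := congrFun e j
  simp only [Pi.add_apply, stdB_apply] at h1 h2
  rw [Fin.lt_def] at h h'
  rw [Fin.ext_iff, Fin.ext_iff]
  split_ifs at h1 h2 <;> omega

theorem mm_inj (n : ℕ) (i j i' j' : Fin n) (h : i < j) (h' : i' < j')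
    (e : stdB n i - stdB n j = stdB n i' - stdB n j') : i = i' ∧ j = j' := by
  have h1 := congrFun e i
  have h2 := congrFun e j
  simp only [Pi.sub_apply, stdB_apply] at h1 h2
  rw [Fin.lt_def] at h h'
  rw [Fin.ext_iff, Fin.ext_iff]
  split_ifs at h1 h2 <;> omega

theorem ss_inj (n : ℕ) (i i' : Fin n) (e : stdB n i = stdB n i') : i = i' := by
  have h1 := congrFun e i
  simp only [stdB_apply] at h1
  rw [Fin.ext_iff]
  split_ifs at h1 <;> omega

/-- Total sum. -/
def totB (n : ℕ) : (Fin n → ℤ) →+ ℤ where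
  toFun x := ∑ i, x i
  map_zero' := by simp
  map_add' x y := by simp [Finset.sum_add_distrib]

theorem totB_std (n : ℕ) (i : Fin n) : totB n (stdB n i) = 1 := by
  simp [totB, stdB, Pi.single_apply]

theorem totB_mono (n : ℕ) (a b : Fin n → ℤ) (h : rootLeB n a b) : totB n a ≤ totB n b := by
  rcases n with _ | n
  · simp [totB]
  · have := psB_mono _ a b h (Fin.last n)
    simpa [psB, totB, Fin.le_last] using this

theorem tot_p (n : ℕ) (i j : Fin n) : totB n (stdB n i + stdB n j) = 2 := by
  rw [map_add, totB_std, totB_std]; rfl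

theorem tot_m (n : ℕ) (i j : Fin n) : totB n (stdB n i - stdB n j) = 0 := by
  rw [map_sub, totB_std, totB_std]; rfl

theorem mem_fA (n : ℕ) (U : Set (ℕ × ℕ)) (i j : Fin n) (h : i < j) :
    stdB n i + stdB n j ∈ fA n U ↔ ((i : ℕ), (j : ℕ)) ∈ U := by
  constructor
  · rintro ⟨a, b, hab, hU, e⟩
    obtain ⟨rfl, rfl⟩ := pp_inj n _ _ _ _ h hab e
    exact hU
  · intro hU
    exact ⟨i, j, h, hU, rfl⟩

theorem tot_fA (n : ℕ) (U : Set (ℕ × ℕ)) (x : Fin n → ℤ) (hx : x ∈ fA n U) : totB n x = 2 := by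
  obtain ⟨i, j, _, _, rfl⟩ := hx
  exact tot_p n i j

theorem mem_fB_p (n : ℕ) (U : Set (ℕ × ℕ)) (i j : Fin n) (h : i < j) :
    stdB n i + stdB n j ∈ fB n U ↔ ((i : ℕ) = 0 ∨ ((i : ℕ), (j : ℕ)) ∈ U) := by
  constructor
  · rintro (⟨a, b, hab, hU, e⟩ | ⟨a, _, e⟩ | ⟨a, b, _, _, _, e⟩)
    · obtain ⟨rfl, rfl⟩ := pp_inj n _ _ _ _ h hab e
      exact hU
    · have := congrArg (totB n) e
      rw [tot_p, totB_std] at this; omega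
    · have := congrArg (totB n) e
      rw [tot_p, tot_m] at this; omega
  · intro hU
    exact Or.inl ⟨i, j, h, hU, rfl⟩

theorem mem_fB_s (n : ℕ) (U : Set (ℕ × ℕ)) (i : Fin n) :
    stdB n i ∈ fB n U ↔ (i : ℕ) = 0 := by
  constructor
  · rintro (⟨a, b, hab, hU, e⟩ | ⟨a, h, e⟩ | ⟨a, b, _, _, _, e⟩)
    · have := congrArg (totB n) e
      rw [tot_p, totB_std] at this; omega
    · rw [ss_inj n _ _ e]; exact h
    · have := congrArg (totB n) e
      rw [totB_std, tot_m] at this; omega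
  · intro hU
    exact Or.inr (Or.inl ⟨i, hU, rfl⟩)

theorem mem_fB_m (n : ℕ) (U : Set (ℕ × ℕ)) (i j : Fin n) (h : i < j) :
    stdB n i - stdB n j ∈ fB n U ↔ ((i : ℕ) = 0 ∧ (0, (j : ℕ)) ∉ U) := by
  constructor
  · rintro (⟨a, b, hab, hU, e⟩ | ⟨a, _, e⟩ | ⟨a, b, hab, h0, hU, e⟩)
    · have := congrArg (totB n) e
      rw [tot_p, tot_m] at this; omega
    · have := congrArg (totB n) e
      rw [tot_m, totB_std] at this; omega
    · obtain ⟨rfl, rfl⟩ := mm_inj n _ _ _ _ h hab e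
      exact ⟨h0, hU⟩
  · intro hU
    exact Or.inr (Or.inr ⟨i, j, h, hU.1, hU.2, rfl⟩)

def abB (n : ℕ) : Set (Set (Fin n → ℤ)) :=
  {S | isUpperB n S ∧ (∀ a ∈ S, ∀ b ∈ S, a + b ∉ posB n)}

theorem fA_inj (n : ℕ) : Set.InjOn (fA n) (stairB n) := by
  intro U hU V hV h
  ext ⟨i, j⟩
  constructor
  · intro hm
    have h1 := hU.1 _ _ hm
    have h2 := (mem_fA n U ⟨i, by omega⟩ ⟨j, h1.2⟩ h1.1).2 hm
    rw [h] at h2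
    exact (mem_fA n V ⟨i, by omega⟩ ⟨j, h1.2⟩ h1.1).1 h2
  · intro hm
    have h1 := hV.1 _ _ hm
    have h2 := (mem_fA n V ⟨i, by omega⟩ ⟨j, h1.2⟩ h1.1).2 hm
    rw [← h] at h2
    exact (mem_fA n U ⟨i, by omega⟩ ⟨j, h1.2⟩ h1.1).1 h2

theorem fB_sub (n : ℕ) (U V : Set (ℕ × ℕ)) (hU : U ∈ stairB n) (h : fB n U = fB n V) :
    U ⊆ V := by
  rintro ⟨i, j⟩ hm
  have h1 := hU.1 _ _ hm
  by_cases hi : i = 0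
  · subst hi
    by_contra hc
    have h2 := (mem_fB_m n V ⟨0, by omega⟩ ⟨j, h1.2⟩ h1.1).2 ⟨rfl, hc⟩
    rw [← h] at h2
    exact ((mem_fB_m n U ⟨0, by omega⟩ ⟨j, h1.2⟩ h1.1).1 h2).2 hm
  · have h2 := (mem_fB_p n U ⟨i, by omega⟩ ⟨j, h1.2⟩ h1.1).2 (Or.inr hm)
    rw [h] at h2
    exact ((mem_fB_p n V ⟨i, by omega⟩ ⟨j, h1.2⟩ h1.1).1 h2).resolve_left hi

theorem fB_inj (n : ℕ) : Set.InjOn (fB n) (stairB n) := by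
  intro U hU V hV h
  exact Set.Subset.antisymm (fB_sub n U V hU h) (fB_sub n V U hV h.symm)

theorem pos_tot_le (n : ℕ) (x : Fin n → ℤ) (h : x ∈ posB n) : totB n x ≤ 2 := by
  rcases h with ⟨i, j, _, rfl⟩ | ⟨i, j, _, rfl⟩ | ⟨i, rfl⟩
  · rw [tot_m]; omega
  · rw [tot_p]
  · rw [totB_std]; omega

theorem pos_coord_le (n : ℕ) (x : Fin n → ℤ) (h : x ∈ posB n) (k : Fin n) : x k ≤ 1 := by
  rcases h with ⟨i, j, hij, rfl⟩ | ⟨i, j, hij, rfl⟩ | ⟨i, rfl⟩ <;>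
  simp only [Pi.add_apply, Pi.sub_apply, stdB_apply] <;>
  split_ifs <;> omega

theorem le_p_dest (n : ℕ) (i j : Fin n) (hij : i < j) (b : Fin n → ℤ) (hb : b ∈ posB n)
    (h : rootLeB n (stdB n i + stdB n j) b) :
    ∃ i' j' : Fin n, i' < j' ∧ (i' : ℕ) ≤ i ∧ (j' : ℕ) ≤ j ∧ b = stdB n i' + stdB n j' := by
  have ht := totB_mono n _ _ h
  rw [tot_p] at ht
  rcases hb with ⟨i', j', hij', rfl⟩ | ⟨i', j', hij', rfl⟩ | ⟨i', rfl⟩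
  · rw [tot_m] at ht; omega
  · have h1 := psB_mono n _ _ h i
    have h2 := psB_mono n _ _ h j
    simp only [map_add, psB_std] at h1 h2
    refine ⟨i', j', hij', ?_, ?_, rfl⟩ <;> rw [Fin.lt_def] at hij hij' <;>
    split_ifs at h1 h2 <;> omega
  · rw [totB_std] at ht; omega

theorem fA_mem (n : ℕ) (U : Set (ℕ × ℕ)) (hU : U ∈ stairB n) : fA n U ∈ abB n := by
  refine ⟨⟨?_, ?_⟩, ?_⟩
  · rintro x ⟨i, j, hij, _, rfl⟩
    exact Or.inr (Or.inl ⟨i, j, hij, rfl⟩)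
  · rintro a ⟨i, j, hij, hm, rfl⟩ b hb hle
    obtain ⟨i', j', hij', hi, hj, rfl⟩ := le_p_dest n i j hij b hb hle
    exact ⟨i', j', hij', hU.2 _ _ _ _ hm hi hj hij', rfl⟩
  · intro a ha b hb hab
    have := pos_tot_le n _ hab
    rw [map_add, tot_fA n U a ha, tot_fA n U b hb] at this
    omega

theorem fB_upper (n : ℕ) (U : Set (ℕ × ℕ)) (hU : U ∈ stairB n) : isUpperB n (fB n U) := by
  refine ⟨?_, ?_⟩
  · rintro x (⟨i, j, hij, _, rfl⟩ | ⟨i, _, rfl⟩ | ⟨i, j, hij, _, _, rfl⟩)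
    · exact Or.inr (Or.inl ⟨i, j, hij, rfl⟩)
    · exact Or.inr (Or.inr ⟨i, rfl⟩)
    · exact Or.inl ⟨i, j, hij, rfl⟩
  · rintro x (⟨i, j, hij, hm, rfl⟩ | ⟨i, h0, rfl⟩ | ⟨i, j, hij, h0, hm, rfl⟩) b hb hle
    · obtain ⟨i', j', hij', hi, hj, rfl⟩ := le_p_dest n i j hij b hb hle
      rw [mem_fB_p n U _ _ hij']
      rcases hm with hm | hm
      · left; omega
      · right; exact hU.2 _ _ _ _ hm hi hj hij'
    · have ht := totB_mono n _ _ hle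
      have h1 := psB_mono n _ _ hle i
      rcases hb with ⟨i', j', hij', rfl⟩ | ⟨i', j', hij', rfl⟩ | ⟨i', rfl⟩
      · rw [tot_m, totB_std] at ht; omega
      · rw [mem_fB_p n U _ _ hij']
        left
        simp only [map_add, psB_std] at h1
        rw [Fin.lt_def] at hij'
        split_ifs at h1 <;> omega
      · rw [mem_fB_s]
        simp only [psB_std] at h1
        split_ifs at h1 <;> omega
    · have h1 := psB_mono n _ _ hle i
      rw [Fin.lt_def] at hij
      rcases hb with ⟨i', j', hij', rfl⟩ | ⟨i', j', hij', rfl⟩ | ⟨i', rfl⟩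
      · rw [mem_fB_m n U _ _ hij']
        have h2 := psB_mono n _ _ hle j'
        simp only [map_sub, psB_std] at h1 h2
        rw [Fin.lt_def] at hij'
        have h3 : (i' : ℕ) = 0 := by split_ifs at h1 <;> omega
        have h4 : (j : ℕ) ≤ j' := by split_ifs at h2 <;> omega
        exact ⟨h3, fun hc => hm (hU.2 _ _ _ _ hc le_rfl h4 (by omega))⟩
      · rw [mem_fB_p n U _ _ hij']
        left
        simp only [map_add, map_sub, psB_std] at h1
        rw [Fin.lt_def] at hij'
        split_ifs at h1 <;> omega
      · rw [mem_fB_s]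
        simp only [map_sub, psB_std] at h1
        split_ifs at h1 <;> omega

theorem fB_row0 (n : ℕ) (U : Set (ℕ × ℕ)) (z : Fin n) (hz : (z : ℕ) = 0) (a : Fin n → ℤ)
    (ha : a ∈ fB n U) :
    (a z = 1 ∧ (2 ≤ totB n a + 1 ∨
      ∃ j : Fin n, z < j ∧ (0, (j : ℕ)) ∉ U ∧ a = stdB n z - stdB n j)) ∨
    (∃ i j : Fin n, z < i ∧ i < j ∧ ((i : ℕ), (j : ℕ)) ∈ U ∧ a = stdB n i + stdB n j) := by
  rcases ha with ⟨i, j, hij, hm, rfl⟩ | ⟨i, h0, rfl⟩ | ⟨i, j, hij, h0, hm, rfl⟩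
  · by_cases hi : (i : ℕ) = 0
    · left
      rw [tot_p]
      refine ⟨?_, by omega⟩
      rw [Fin.lt_def] at hij
      simp only [Pi.add_apply, stdB_apply]
      rw [if_pos (by omega), if_neg (by omega)]; rfl
    · right
      exact ⟨i, j, by rw [Fin.lt_def]; omega, hij, hm.resolve_left hi, rfl⟩
  · left
    rw [totB_std, stdB_apply, if_pos (by omega)]
    omega
  · left
    obtain rfl : i = z := Fin.ext (by omega)
    refine ⟨?_, Or.inr ⟨j, hij, hm, rfl⟩⟩
    rw [Fin.lt_def] at hij
    simp only [Pi.sub_apply, stdB_apply]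
    rw [if_pos trivial, if_neg (by omega)]; rfl

theorem fB_cross (n : ℕ) (U : Set (ℕ × ℕ)) (hU : U ∈ stairB n) (z : Fin n) (hz : (z : ℕ) = 0)
    (a : Fin n → ℤ) (h : 2 ≤ totB n a + 1 ∨
      ∃ j : Fin n, z < j ∧ (0, (j : ℕ)) ∉ U ∧ a = stdB n z - stdB n j)
    (i j : Fin n) (hzi : z < i) (hij : i < j) (hm : ((i : ℕ), (j : ℕ)) ∈ U) :
    a + (stdB n i + stdB n j) ∉ posB n := by
  intro hp
  have ht := pos_tot_le n _ hp
  rcases h with h | ⟨k, hzk, hk, rfl⟩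
  · rw [map_add, tot_p] at ht; omega
  · rw [Fin.lt_def] at hzi hij hzk
    have hjk : (j : ℕ) < k := by
      by_contra hc
      exact hk (hU.2 _ _ _ _ hm (by omega) (by omega) (by omega))
    have key : ∀ y : Fin n → ℤ, y z = 1 → y i = 1 → y j = 1 → y ∉ posB n := by
      intro y h1 h2 h3 hy
      rcases hy with ⟨p, q, hpq, rfl⟩ | ⟨p, q, hpq, rfl⟩ | ⟨p, rfl⟩ <;>
      simp only [Pi.add_apply, Pi.sub_apply, stdB_apply] at h1 h2 h3 <;>
      split_ifs at h1 h2 h3 <;> omega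
    refine key _ ?_ ?_ ?_ hp <;> simp only [Pi.add_apply, Pi.sub_apply, stdB_apply] <;>
      split_ifs <;> omega

theorem fB_mem (n : ℕ) (hn : 1 ≤ n) (U : Set (ℕ × ℕ)) (hU : U ∈ stairB n) : fB n U ∈ abB n := by
  refine ⟨fB_upper n U hU, ?_⟩
  intro a ha b hb hp
  have hz : ((⟨0, hn⟩ : Fin n) : ℕ) = 0 := rfl
  generalize (⟨0, hn⟩ : Fin n) = z at hz
  rcases fB_row0 n U z hz a ha with ⟨a1, a2⟩ | ⟨i, j, hzi, hij, hm, rfl⟩ <;>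
  rcases fB_row0 n U z hz b hb with ⟨b1, b2⟩ | ⟨i', j', hzi', hij', hm', rfl⟩
  · have := pos_coord_le n _ hp z
    rw [Pi.add_apply] at this
    omega
  · exact fB_cross n U hU z hz a a2 i' j' hzi' hij' hm' hp
  · rw [add_comm] at hp
    exact fB_cross n U hU z hz b b2 i j hzi hij hm hp
  · have ht := pos_tot_le n _ hp
    rw [map_add, tot_p, tot_p] at ht
    omega

theorem abB_eq (n : ℕ) (hn : 1 ≤ n) : abB n = fA n '' stairB n ∪ fB n '' stairB n := by
  apply Set.Subset.antisymm
  · rintro S ⟨⟨hpos, hup⟩, hab⟩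
    have hz : ((⟨0, hn⟩ : Fin n) : ℕ) = 0 := rfl
    generalize (⟨0, hn⟩ : Fin n) = z at hz
    have posp : ∀ i j : Fin n, i < j → stdB n i + stdB n j ∈ posB n := fun i j h =>
      Or.inr (Or.inl ⟨i, j, h, rfl⟩)
    have posm : ∀ i j : Fin n, i < j → stdB n i - stdB n j ∈ posB n := fun i j h =>
      Or.inl ⟨i, j, h, rfl⟩
    have poss : ∀ i : Fin n, stdB n i ∈ posB n := fun i => Or.inr (Or.inr ⟨i, rfl⟩)
    have hs0 : ∀ i : Fin n, stdB n i ∈ S → stdB n z ∈ S := fun i hi =>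
      hup _ hi _ (poss z) (le_ss n i z (by omega))
    have hs : ∀ i : Fin n, stdB n i ∈ S → i = z := by
      intro i hi
      by_contra hc
      have hlt : z < i := by
        rw [Fin.lt_def]
        rw [Fin.ext_iff] at hc
        omega
      exact hab _ (hs0 i hi) _ hi (posp z i hlt)
    have hms : ∀ i j : Fin n, stdB n i - stdB n j ∈ S → stdB n i ∈ S := fun i j h =>
      hup _ h _ (poss i) (le_ms n i j)
    by_cases h0 : stdB n z ∈ S
    · right
      have hmm : ∀ j j' : Fin n, z < j → (j : ℕ) ≤ j' → stdB n z - stdB n j ∈ S →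
          stdB n z - stdB n j' ∈ S := fun j j' hj hjj h =>
        hup _ h _ (posm z j' (by rw [Fin.lt_def] at *; omega)) (le_mm n z j j' hjj)
      refine ⟨{p | (∃ i j : Fin n, z < i ∧ i < j ∧ p = ((i : ℕ), (j : ℕ)) ∧
          stdB n i + stdB n j ∈ S) ∨
          (∃ j : Fin n, z < j ∧ p = (0, (j : ℕ)) ∧ stdB n z - stdB n j ∉ S)}, ⟨?_, ?_⟩, ?_⟩
      · rintro i j (⟨a, b, hza, hab, e, _⟩ | ⟨b, hzb, e, _⟩)
        · simp only [Prod.mk.injEq] at e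
          rw [Fin.lt_def] at hab
          omega
        · simp only [Prod.mk.injEq] at e
          rw [Fin.lt_def] at hzb
          omega
      · rintro i j i' j' (⟨a, b, hza, hlt, e, hm⟩ | ⟨b, hzb, e, hm⟩) hi hj hlt'
        · simp only [Prod.mk.injEq] at e
          obtain ⟨rfl, rfl⟩ := e
          by_cases hi' : i' = 0
          · subst hi'
            have hzj : z < (⟨j', by omega⟩ : Fin n) := by
              rw [Fin.lt_def]; simp; omega
            refine Or.inr ⟨⟨j', by omega⟩, hzj, rfl, fun hc => ?_⟩
            have h1 := hmm _ b hzj hj hc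
            refine hab _ h1 _ hm ?_
            have : stdB n z - stdB n b + (stdB n a + stdB n b) = stdB n z + stdB n a := by abel
            rw [this]
            exact posp z a hza
          · refine Or.inl ⟨⟨i', by omega⟩, ⟨j', by omega⟩, ?_, hlt', rfl, ?_⟩
            · rw [Fin.lt_def]; simp; omega
            · exact hup _ hm _ (posp _ _ hlt') (le_pp n _ _ _ _ hi hj)
        · simp only [Prod.mk.injEq] at e
          obtain ⟨rfl, rfl⟩ := e
          obtain rfl : i' = 0 := by omega
          have hzj : z < (⟨j', by omega⟩ : Fin n) := by
            rw [Fin.lt_def]; simp; omega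
          refine Or.inr ⟨⟨j', by omega⟩, hzj, rfl, fun hc => ?_⟩
          exact hm (hmm _ b hzj hj hc)
      · apply Set.Subset.antisymm
        · rintro x (⟨i, j, hij, hm, rfl⟩ | ⟨i, hi, rfl⟩ | ⟨i, j, hij, hi, hm, rfl⟩)
          · rcases hm with hi | ⟨a, b, _, _, e, hm⟩ | ⟨b, hzb, e, hm⟩
            · obtain rfl : i = z := Fin.ext (by omega)
              exact hup _ h0 _ (posp _ _ hij) (le_sp n i j)
            · simp only [Prod.mk.injEq, ← Fin.ext_iff] at e
              obtain ⟨rfl, rfl⟩ := e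
              exact hm
            · simp only [Prod.mk.injEq] at e
              obtain rfl : i = z := Fin.ext (by omega)
              exact hup _ h0 _ (posp _ _ hij) (le_sp n i j)
          · obtain rfl : i = z := Fin.ext (by omega)
            exact h0
          · obtain rfl : i = z := Fin.ext (by omega)
            by_contra hc
            exact hm (Or.inr ⟨j, hij, rfl, hc⟩)
        · intro x hx
          rcases hpos hx with ⟨i, j, hij, rfl⟩ | ⟨i, j, hij, rfl⟩ | ⟨i, rfl⟩
          · obtain rfl := hs i (hms i j hx)
            rw [mem_fB_m _ _ _ _ hij]
            refine ⟨hz, ?_⟩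
            rintro (⟨a, b, hza, _, e, hm⟩ | ⟨b, hzb, e, hm⟩)
            · simp only [Prod.mk.injEq] at e
              rw [Fin.lt_def] at hza
              omega
            · simp only [Prod.mk.injEq, ← Fin.ext_iff] at e
              obtain ⟨_, rfl⟩ := e
              exact hm hx
          · rw [mem_fB_p _ _ _ _ hij]
            by_cases hi : (i : ℕ) = 0
            · exact Or.inl hi
            · exact Or.inr (Or.inl ⟨i, j, by rw [Fin.lt_def]; omega, hij, rfl, hx⟩)
          · rw [mem_fB_s, hs i hx]
            exact hz
    · left
      refine ⟨{p | ∃ i j : Fin n, i < j ∧ p = ((i : ℕ), (j : ℕ)) ∧ stdB n i + stdB n j ∈ S},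
        ⟨?_, ?_⟩, ?_⟩
      · rintro i j ⟨a, b, hab, e, _⟩
        simp only [Prod.mk.injEq] at e
        rw [Fin.lt_def] at hab
        omega
      · rintro i j i' j' ⟨a, b, hlt, e, hm⟩ hi hj hlt'
        simp only [Prod.mk.injEq] at e
        obtain ⟨rfl, rfl⟩ := e
        refine ⟨⟨i', by omega⟩, ⟨j', by omega⟩, hlt', rfl, ?_⟩
        exact hup _ hm _ (posp _ _ hlt') (le_pp n _ _ _ _ hi hj)
      · apply Set.Subset.antisymm
        · rintro x ⟨i, j, hij, ⟨a, b, _, e, hm⟩, rfl⟩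
          simp only [Prod.mk.injEq, ← Fin.ext_iff] at e
          obtain ⟨rfl, rfl⟩ := e
          exact hm
        · intro x hx
          rcases hpos hx with ⟨i, j, hij, rfl⟩ | ⟨i, j, hij, rfl⟩ | ⟨i, rfl⟩
          · exact absurd (hs0 _ (hms i j hx)) h0
          · exact ⟨i, j, hij, ⟨i, j, hij, rfl, hx⟩, rfl⟩
          · exact absurd (hs0 _ hx) h0
  · rintro S (⟨U, hU, rfl⟩ | ⟨U, hU, rfl⟩)
    · exact fA_mem n U hU
    · exact fB_mem n hn U hU

theorem abB_card (n : ℕ) (hn : 1 ≤ n) : (abB n).Finite ∧ (abB n).ncard = 2 ^ n := by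
  obtain ⟨m, rfl⟩ : ∃ m, n = m + 1 := ⟨n - 1, by omega⟩
  obtain ⟨hf, hc⟩ := stairB_card m
  rw [abB_eq _ hn]
  refine ⟨(hf.image _).union (hf.image _), ?_⟩
  rw [Set.ncard_union_eq _ (hf.image _) (hf.image _), (fA_inj _).ncard_image,
    (fB_inj _).ncard_image, hc]
  · ring
  · rw [Set.disjoint_left]
    rintro S ⟨U, _, rfl⟩ ⟨V, _, h⟩
    have h1 : stdB (m + 1) 0 ∈ fB (m + 1) V := (mem_fB_s _ _ _).2 rfl
    rw [h] at h1
    have := tot_fA _ _ _ h1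
    rw [totB_std] at this
    omega

theorem empty_stairB (n : ℕ) : ∅ ∈ stairB n := by
  constructor <;> simp

theorem simple_empty (n : ℕ) (hn : 1 ≤ n) : (fB n ∅ ∩ simpleB n).ncard = 1 := by
  rw [Set.ncard_eq_one]
  by_cases h1 : n = 1
  · refine ⟨stdB n ⟨0, hn⟩, ?_⟩
    apply Set.Subset.antisymm
    · rintro x ⟨_, ⟨i, j, hij, rfl⟩ | ⟨i, hi, rfl⟩⟩
      · omega
      · rw [Set.mem_singleton_iff]
        congr 1
        apply Fin.ext
        simp; omega
    · rw [Set.singleton_subset_iff]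
      exact ⟨(mem_fB_s _ _ _).2 rfl, Or.inr ⟨⟨0, hn⟩, by simp; omega, rfl⟩⟩
  · refine ⟨stdB n ⟨0, hn⟩ - stdB n ⟨1, by omega⟩, ?_⟩
    apply Set.Subset.antisymm
    · rintro x ⟨hx, ⟨i, j, hij, rfl⟩ | ⟨i, hi, rfl⟩⟩
      · rw [mem_fB_m _ _ _ _ (by rw [Fin.lt_def]; omega)] at hx
        rw [Set.mem_singleton_iff]
        congr 2 <;> apply Fin.ext <;> simp <;> omega
      · rw [mem_fB_s] at hx
        omega
    · rw [Set.singleton_subset_iff]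
      refine ⟨(mem_fB_m _ _ _ _ ?_).2 ⟨rfl, by simp⟩, Or.inl ⟨_, _, ?_, rfl⟩⟩
      · rw [Fin.lt_def]; simp
      · simp

theorem simple_other (n : ℕ) (hn : 1 ≤ n) (S : Set (Fin n → ℤ)) (hS : S ∈ abB n)
    (hne : S ≠ fB n ∅) : (S ∩ simpleB n).ncard = 0 := by
  have : S ∩ simpleB n = ∅ := by
    rw [abB_eq n hn] at hS
    rw [Set.eq_empty_iff_forall_notMem]
    rcases hS with ⟨U, hU, rfl⟩ | ⟨U, hU, rfl⟩
    · rintro x ⟨hx, ⟨i, j, hij, rfl⟩ | ⟨i, hi, rfl⟩⟩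
      · have := tot_fA _ _ _ hx
        rw [tot_m] at this; omega
      · have := tot_fA _ _ _ hx
        rw [totB_std] at this; omega
    · obtain ⟨⟨i, j⟩, hm⟩ : U.Nonempty := by
        rw [Set.nonempty_iff_ne_empty]
        rintro rfl
        exact hne rfl
      have hij := hU.1 _ _ hm
      have h01 : (0, 1) ∈ U := hU.2 _ _ _ _ hm (by omega) (by omega) (by omega)
      rintro x ⟨hx, ⟨a, b, hab, rfl⟩ | ⟨a, ha, rfl⟩⟩
      · rw [mem_fB_m _ _ _ _ (by rw [Fin.lt_def]; omega)] at hx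
        have hb : (b : ℕ) = 1 := by omega
        rw [hb] at hx
        exact hx.2 h01
      · rw [mem_fB_s] at hx
        omega
  rw [this, Set.ncard_empty]

theorem stmt_14 (n j : ℕ) (hn : 1 ≤ n) :
    Nat.card {S : Set (Fin n → ℤ) //
        isUpperB n S ∧ (∀ a ∈ S, ∀ b ∈ S, a + b ∉ posB n) ∧ (S ∩ simpleB n).ncard = j} =
      if j = 0 then 2 ^ n - 1 else if j = 1 then 1 else 0 := by
  have hmem : fB n ∅ ∈ abB n := fB_mem n hn ∅ (empty_stairB n)
  have h1 := simple_empty n hn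
  obtain ⟨hf, hc⟩ := abB_card n hn
  change Nat.card ({S : Set (Fin n → ℤ) | isUpperB n S ∧ (∀ a ∈ S, ∀ b ∈ S, a + b ∉ posB n) ∧
    (S ∩ simpleB n).ncard = j} : Set _) = _
  rw [Nat.card_coe_set_eq]
  have hset : {S : Set (Fin n → ℤ) | isUpperB n S ∧ (∀ a ∈ S, ∀ b ∈ S, a + b ∉ posB n) ∧
      (S ∩ simpleB n).ncard = j} = {S | S ∈ abB n ∧ (S ∩ simpleB n).ncard = j} := by
    ext S
    simp only [abB, Set.mem_setOf_eq, and_assoc]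
  rw [hset]
  split_ifs with hj0 hj1
  · subst hj0
    rw [← hc, ← Set.ncard_diff_singleton_of_mem hmem]
    congr 1
    ext S
    constructor
    · rintro ⟨hS, h⟩
      refine ⟨hS, ?_⟩
      rintro rfl
      omega
    · rintro ⟨hS, h⟩
      exact ⟨hS, simple_other n hn S hS h⟩
  · subst hj1
    rw [Set.ncard_eq_one]
    refine ⟨fB n ∅, ?_⟩
    ext S
    constructor
    · rintro ⟨hS, h⟩
      by_contra hne
      have := simple_other n hn S hS hne
      omega
    · rintro rfl
      exact ⟨hmem, h1⟩
  · rw [← Set.ncard_empty (Set (Fin n → ℤ))]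
    congr 1
    rw [Set.eq_empty_iff_forall_notMem]
    rintro S ⟨hS, h⟩
    by_cases hne : S = fB n ∅
    · subst hne
      omega
    · have := simple_other n hn S hS hne
      omega
end

section
/- For n ≥ 1, the number of abelian upper sets S of the root poset of type C_n with |S ∩ Π| = j equals: 2^n − 1 if j = 0; 1 if j = 1; and 0 if j > 1. -/
/-- The set of positive roots of type `C_n`:
`e i - e j` and `e i + e j` for `i < j`, and `2 e i`. -/
def posC (n : ℕ) : Set (Fin n → ℤ) :=
  {x | (∃ i j : Fin n, i < j ∧ x = stdB n i - stdB n j) ∨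
    (∃ i j : Fin n, i < j ∧ x = stdB n i + stdB n j) ∨
    (∃ i : Fin n, x = (2 : ℤ) • stdB n i)}

/-- The set of simple roots of type `C_n`: `α i = e i - e (i+1)` for `i < n - 1`
together with the last simple root `2 e (n-1)`. -/
def simpleC (n : ℕ) : Set (Fin n → ℤ) :=
  {x | (∃ i j : Fin n, (i : ℕ) + 1 = (j : ℕ) ∧ x = stdB n i - stdB n j) ∨
    (∃ i : Fin n, (i : ℕ) + 1 = n ∧ x = (2 : ℤ) • stdB n i)}

/-- The root poset order of type `C_n`. -/
def rootLeC (n : ℕ) (a b : Fin n → ℤ) : Prop :=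
  b - a ∈ AddSubmonoid.closure (simpleC n)

/-- `S` is an upper set of the root poset of type `C_n`. -/
def isUpperC (n : ℕ) (S : Set (Fin n → ℤ)) : Prop :=
  S ⊆ posC n ∧ ∀ a ∈ S, ∀ b ∈ posC n, rootLeC n a b → b ∈ S
open Classical in
/-- Prefix sum functional. -/
noncomputable def pre (n : ℕ) (m : Fin n) : (Fin n → ℤ) →+ ℤ where
  toFun x := ∑ p, if p ≤ m then x p else 0
  map_zero' := by simp
  map_add' x y := by
    rw [← Finset.sum_add_distrib]
    refine Finset.sum_congr rfl fun p _ => ?_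
    split_ifs <;> simp

theorem pre_std (n : ℕ) (m i : Fin n) : pre n m (stdB n i) = if i ≤ m then 1 else 0 := by
  show (∑ p, if p ≤ m then stdB n i p else 0) = _
  rw [Finset.sum_eq_single i]
  · simp [stdB]
  · intro b _ hb
    simp [stdB, hb]
  · simp

theorem pre_nonneg (n : ℕ) (m : Fin n) (x : Fin n → ℤ)
    (hx : x ∈ AddSubmonoid.closure (simpleC n)) : 0 ≤ pre n m x := by
  induction hx using AddSubmonoid.closure_induction with
  | mem x hx =>
    rcases hx with ⟨i, j, hij, rfl⟩ | ⟨i, hi, rfl⟩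
    · rw [map_sub, pre_std, pre_std]
      have : j ≤ m → i ≤ m := fun h => by
        rw [Fin.le_def] at *; omega
      split_ifs <;> simp_all
    · rw [map_zsmul, pre_std]
      split_ifs <;> simp
  | zero => simp
  | add x y _ _ h1 h2 => rw [map_add]; omega

theorem posC_iff (n : ℕ) (x : Fin n → ℤ) : x ∈ posC n ↔
    (∃ i j : Fin n, i < j ∧ x = stdB n i - stdB n j) ∨
    (∃ i j : Fin n, i ≤ j ∧ x = stdB n i + stdB n j) := by
  constructor
  · rintro (h | ⟨i, j, h, rfl⟩ | ⟨i, rfl⟩)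
    · exact Or.inl h
    · exact Or.inr ⟨i, j, h.le, rfl⟩
    · exact Or.inr ⟨i, i, le_rfl, two_smul _ _⟩
  · rintro (h | ⟨i, j, h, rfl⟩)
    · exact Or.inl h
    · rcases h.lt_or_eq with h | rfl
      · exact Or.inr (Or.inl ⟨i, j, h, rfl⟩)
      · exact Or.inr (Or.inr ⟨i, (two_smul _ _).symm⟩)

theorem le_of_rootLe (n : ℕ) (i j k l : Fin n) (hij : i ≤ j) (hkl : k ≤ l)
    (h : rootLeC n (stdB n i + stdB n j) (stdB n k + stdB n l)) : k ≤ i ∧ l ≤ j := by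
  have h1 := pre_nonneg n i _ h
  have h2 := pre_nonneg n j _ h
  simp only [map_sub, map_add, pre_std] at h1 h2
  simp only [Fin.le_def] at *
  constructor
  · by_contra hc
    split_ifs at h1 <;> omega
  · by_contra hc
    split_ifs at h2 <;> omega

theorem not_rootLe (n : ℕ) (i j k l : Fin n) (hij : i ≤ j)
    (h : rootLeC n (stdB n i + stdB n j) (stdB n k - stdB n l)) : False := by
  have h2 := pre_nonneg n j _ h
  simp only [map_sub, map_add, pre_std] at h2
  simp only [Fin.le_def] at *
  split_ifs at h2 <;> omega

theorem std_pair_inj (n : ℕ) (i j k l : Fin n) (hij : i ≤ j) (hkl : k ≤ l)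
    (h : stdB n i + stdB n j = stdB n k + stdB n l) : i = k ∧ j = l := by
  have a := le_of_rootLe n i j k l hij hkl (by rw [rootLeC, h, sub_self]; exact zero_mem _)
  have b := le_of_rootLe n k l i j hkl hij (by rw [rootLeC, h, sub_self]; exact zero_mem _)
  exact ⟨le_antisymm b.1 a.1, le_antisymm b.2 a.2⟩

theorem sub_mem_cl (n : ℕ) (d : ℕ) : ∀ (i j : Fin n), (j : ℕ) = i + d →
    stdB n i - stdB n j ∈ AddSubmonoid.closure (simpleC n) := by
  induction d with
  | zero =>
    intro i j h
    have : j = i := Fin.ext (by omega)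
    subst this
    rw [sub_self]; exact zero_mem _
  | succ d ih =>
    intro i j h
    have hk : (i : ℕ) + d < n := by omega
    have h1 := ih i ⟨i + d, hk⟩ rfl
    have h2 : stdB n ⟨i + d, hk⟩ - stdB n j ∈ AddSubmonoid.closure (simpleC n) :=
      AddSubmonoid.subset_closure (Or.inl ⟨_, _, by simp; omega, rfl⟩)
    have := add_mem h1 h2
    rwa [sub_add_sub_cancel] at this

theorem sub_mem_cl' (n : ℕ) (i j : Fin n) (h : i ≤ j) :
    stdB n i - stdB n j ∈ AddSubmonoid.closure (simpleC n) :=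
  sub_mem_cl n (j - i) i j (by rw [Fin.le_def] at h; omega)

theorem two_mem_cl (n : ℕ) (j : Fin n) :
    stdB n j + stdB n j ∈ AddSubmonoid.closure (simpleC n) := by
  have hl : n - 1 < n := by have := j.isLt; omega
  have h1 := sub_mem_cl' n j ⟨n - 1, hl⟩ (by rw [Fin.le_def]; simp; omega)
  have h2 : (2 : ℤ) • stdB n ⟨n - 1, hl⟩ ∈ AddSubmonoid.closure (simpleC n) :=
    AddSubmonoid.subset_closure (Or.inr ⟨_, by simp; omega, rfl⟩)
  have := add_mem (add_mem h1 h1) h2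
  convert this using 1
  rw [two_smul]; abel

theorem rootLe_of_le (n : ℕ) (i j k l : Fin n) (h1 : k ≤ i) (h2 : l ≤ j) :
    rootLeC n (stdB n i + stdB n j) (stdB n k + stdB n l) := by
  have := add_mem (sub_mem_cl' n k i h1) (sub_mem_cl' n l j h2)
  rw [rootLeC]
  convert this using 1
  abel

/-- diagonal count -/
def cnt (n : ℕ) (A : Finset (Fin n)) (d : ℕ) : ℕ := (A.filter (fun a : Fin n => d ≤ (a : ℕ))).card

theorem cnt_step (n : ℕ) (A : Finset (Fin n)) (d : Fin n) :
    cnt n A d = cnt n A (d + 1) + if d ∈ A then 1 else 0 := by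
  unfold cnt
  split_ifs with h
  · rw [← Finset.card_insert_of_notMem (a := d) (by simp)]
    congr 1
    ext a
    simp only [Finset.mem_filter, Finset.mem_insert, Fin.ext_iff]
    constructor
    · rintro ⟨h1, h2⟩
      by_cases h3 : (a : ℕ) = d
      · exact Or.inl h3
      · exact Or.inr ⟨h1, by omega⟩
    · rintro (h1 | ⟨h1, h2⟩)
      · have : a = d := Fin.ext h1
        subst this
        exact ⟨h, le_rfl⟩
      · exact ⟨h1, by omega⟩
  · rw [add_zero]
    congr 1
    ext a
    simp only [Finset.mem_filter]
    constructor
    · rintro ⟨h1, h2⟩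
      refine ⟨h1, ?_⟩
      by_contra h3
      have : a = d := Fin.ext (by omega)
      subst this
      exact h h1
    · rintro ⟨h1, h2⟩
      exact ⟨h1, by omega⟩

theorem cnt_ge (n : ℕ) (A : Finset (Fin n)) (d : ℕ) (h : n ≤ d) : cnt n A d = 0 := by
  unfold cnt
  rw [Finset.card_eq_zero, Finset.filter_eq_empty_iff]
  intro a _
  omega

theorem cnt_le_one (n : ℕ) (A : Finset (Fin n)) (d : ℕ) : cnt n A d ≤ cnt n A (d + 1) + 1 := by
  by_cases h : d < n
  · have := cnt_step n A ⟨d, h⟩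
    simp only at this
    split_ifs at this <;> omega
  · rw [cnt_ge n A d (by omega)]; omega

theorem cnt_anti (n : ℕ) (A : Finset (Fin n)) (d e : ℕ) (h : d ≤ e) :
    cnt n A e ≤ cnt n A d := by
  unfold cnt
  apply Finset.card_le_card
  intro a
  simp only [Finset.mem_filter]
  rintro ⟨h1, h2⟩
  exact ⟨h1, by omega⟩

theorem cnt_add (n : ℕ) (A : Finset (Fin n)) (d e : ℕ) : cnt n A d ≤ cnt n A (d + e) + e := by
  induction e with
  | zero => simp
  | succ e ih => have := cnt_le_one n A (d + e); rw [← add_assoc d e 1]; omega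

theorem cnt_le (n : ℕ) (A : Finset (Fin n)) (d : ℕ) : cnt n A d ≤ n - d := by
  have := cnt_add n A d (n - d)
  rw [cnt_ge n A (d + (n - d)) (by omega)] at this
  omega

theorem cnt_inj (n : ℕ) (A B : Finset (Fin n)) (h : ∀ d, cnt n A d = cnt n B d) : A = B := by
  ext d
  have h1 := cnt_step n A d
  have h2 := cnt_step n B d
  rw [h, h] at h1
  by_cases ha : d ∈ A <;> by_cases hb : d ∈ B <;> simp [ha, hb] at h1 h2 ⊢ <;> omega

theorem cnt_surj (n : ℕ) (c : ℕ → ℕ) (h0 : ∀ d, n ≤ d → c d = 0)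
    (h1 : ∀ d, c (d + 1) ≤ c d) (h2 : ∀ d, c d ≤ c (d + 1) + 1) :
    ∃ A : Finset (Fin n), ∀ d, cnt n A d = c d := by
  refine ⟨Finset.univ.filter (fun d => c d = c (d + 1) + 1), ?_⟩
  have key : ∀ k d, n ≤ d + k →
      cnt n (Finset.univ.filter (fun d : Fin n => c d = c (d + 1) + 1)) d = c d := by
    intro k
    induction k with
    | zero => intro d hd; rw [cnt_ge _ _ _ (by omega), h0 _ (by omega)]
    | succ k ih =>
      intro d hd
      by_cases hdn : d < n
      · have := cnt_step n (Finset.univ.filter (fun d : Fin n => c d = c (d + 1) + 1)) ⟨d, hdn⟩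
        simp only [Finset.mem_filter, Finset.mem_univ, true_and] at this
        rw [this, ih (d + 1) (by omega)]
        have := h1 d
        have := h2 d
        split_ifs <;> omega
      · rw [cnt_ge _ _ _ (by omega), h0 _ (by omega)]
  intro d
  exact key n d (by omega)

/-- The upper set attached to a subset. -/
def upT (n : ℕ) (A : Finset (Fin n)) : Set (Fin n → ℤ) :=
  {x | ∃ i j : Fin n, i ≤ j ∧ x = stdB n i + stdB n j ∧ (i : ℕ) < cnt n A (j - i)}

theorem mem_upT (n : ℕ) (A : Finset (Fin n)) (i j : Fin n) (h : i ≤ j) :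
    stdB n i + stdB n j ∈ upT n A ↔ (i : ℕ) < cnt n A (j - i) := by
  constructor
  · rintro ⟨k, l, hkl, he, hc⟩
    obtain ⟨rfl, rfl⟩ := std_pair_inj n i j k l h hkl he
    exact hc
  · intro hc
    exact ⟨i, j, h, rfl, hc⟩

theorem upT_inj (n : ℕ) (A B : Finset (Fin n)) (h : upT n A = upT n B) : A = B := by
  apply cnt_inj
  have key : ∀ A B : Finset (Fin n), upT n A = upT n B → ∀ d, cnt n A d ≤ cnt n B d := by
    intro A B h d
    by_contra hc
    have hle := cnt_le n A d
    have hi : cnt n B d + d < n := by omega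
    have hm : stdB n ⟨cnt n B d, by omega⟩ + stdB n ⟨cnt n B d + d, hi⟩ ∈ upT n A := by
      rw [mem_upT _ _ _ _ (by rw [Fin.le_def]; simp)]
      simp only [Nat.add_sub_cancel_left]
      omega
    rw [h, mem_upT _ _ _ _ (by rw [Fin.le_def]; simp)] at hm
    simp only [Nat.add_sub_cancel_left] at hm
    omega
  exact fun d => le_antisymm (key A B h d) (key B A h.symm d)

theorem upT_upper (n : ℕ) (A : Finset (Fin n)) : isUpperC n (upT n A) := by
  constructor
  · rintro x ⟨i, j, h, rfl, _⟩
    exact (posC_iff n _).2 (Or.inr ⟨i, j, h, rfl⟩)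
  · rintro a ⟨i, j, h, rfl, hc⟩ b hb hab
    rcases (posC_iff n _).1 hb with ⟨k, l, hkl, rfl⟩ | ⟨k, l, hkl, rfl⟩
    · exact (not_rootLe n i j k l h hab).elim
    · obtain ⟨h1, h2⟩ := le_of_rootLe n i j k l h hkl hab
      rw [mem_upT _ _ _ _ hkl]
      simp only [Fin.le_def] at *
      have e1 := cnt_add n A (j - i) (i - k)
      have e2 := cnt_anti n A (l - k) (j - i + (i - k)) (by omega)
      omega

theorem upT_abelian (n : ℕ) (A : Finset (Fin n)) :
    ∀ a ∈ upT n A, ∀ b ∈ upT n A, a + b ∉ posC n := by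
  rintro a ⟨i, j, h, rfl, _⟩ b ⟨k, l, h', rfl, _⟩ hp
  have hn : n - 1 < n := by omega
  have hle : ∀ i : Fin n, i ≤ ⟨n - 1, hn⟩ := fun i => by
    rw [Fin.le_def]; simp; omega
  rcases (posC_iff n _).1 hp with ⟨p, q, _, he⟩ | ⟨p, q, _, he⟩
  all_goals
    have := congrArg (pre n ⟨n - 1, hn⟩) he
    simp [pre_std, hle] at this

theorem upT_surj (n : ℕ) (S : Set (Fin n → ℤ)) (hS : isUpperC n S)
    (hab : ∀ a ∈ S, ∀ b ∈ S, a + b ∉ posC n) : ∃ A, S = upT n A := by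
  obtain ⟨hsub, hup⟩ := hS
  have hform : ∀ x ∈ S, ∃ i j : Fin n, i ≤ j ∧ x = stdB n i + stdB n j := by
    intro x hx
    rcases (posC_iff n _).1 (hsub hx) with ⟨i, j, hij, rfl⟩ | h
    · exfalso
      have hm : stdB n i + stdB n j ∈ S := by
        refine hup _ hx _ ((posC_iff n _).2 (Or.inr ⟨i, j, hij.le, rfl⟩)) ?_
        rw [rootLeC]
        convert two_mem_cl n j using 1
        abel
      refine hab _ hx _ hm ((posC_iff n _).2 (Or.inr ⟨i, i, le_rfl, ?_⟩))
      abel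
    · exact h
  have hmono : ∀ i j k l : Fin n, k ≤ l → k ≤ i → l ≤ j →
      stdB n i + stdB n j ∈ S → stdB n k + stdB n l ∈ S := fun i j k l h h1 h2 hm =>
    hup _ hm _ ((posC_iff n _).2 (Or.inr ⟨k, l, h, rfl⟩)) (rootLe_of_le n i j k l h1 h2)
  let P : ℕ → ℕ → Prop := fun d i =>
    ∃ h : i + d < n, stdB n ⟨i, by omega⟩ + stdB n ⟨i + d, h⟩ ∈ S
  have hP : ∀ d e i k, k ≤ i → k + e ≤ i + d → P d i → P e k := by
    rintro d e i k h1 h2 ⟨h, hm⟩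
    refine ⟨by omega, hmono _ _ _ _ ?_ ?_ ?_ hm⟩ <;> rw [Fin.le_def] <;> simp <;> omega
  have hc : ∀ d, ∃ c, ∀ i, P d i ↔ i < c := by
    classical
    intro d
    have hex : ∃ i, ¬ P d i := ⟨n, fun ⟨h, _⟩ => by omega⟩
    refine ⟨Nat.find hex, fun i => ⟨fun hi => ?_, fun hi => ?_⟩⟩
    · by_contra hlt
      exact Nat.find_spec hex (hP d d i _ (by omega) (by omega) hi)
    · by_contra hn
      exact Nat.find_min hex hi hn
  choose c hc using hc
  have hex : ∃ A : Finset (Fin n), ∀ d, cnt n A d = c d := by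
    refine cnt_surj n c ?_ ?_ ?_
    · intro d hd
      by_contra h
      obtain ⟨h, _⟩ := (hc d 0).2 (by omega)
      omega
    · intro d
      by_contra h
      have := (hc d (c d)).1 (hP (d + 1) d _ _ le_rfl (by omega) ((hc (d + 1) (c d)).2 (by omega)))
      omega
    · intro d
      by_contra h
      have := (hc (d + 1) (c (d + 1))).1
        (hP d (d + 1) (c (d + 1) + 1) _ (by omega) (by omega) ((hc d _).2 (by omega)))
      omega
  obtain ⟨A, hA⟩ := hex
  refine ⟨A, ?_⟩
  have hmem : ∀ i j : Fin n, i ≤ j →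
      (stdB n i + stdB n j ∈ S ↔ stdB n i + stdB n j ∈ upT n A) := by
    intro i j hij
    rw [mem_upT _ _ _ _ hij, hA, ← hc]
    rw [Fin.le_def] at hij
    have e : (⟨(i : ℕ) + (j - i), by omega⟩ : Fin n) = j := Fin.ext (by simp; omega)
    constructor
    · intro h
      exact ⟨by omega, by rw [e]; exact h⟩
    · rintro ⟨_, h⟩
      rw [e] at h; exact h
  ext x
  constructor
  · intro hx
    obtain ⟨i, j, hij, rfl⟩ := hform x hx
    exact (hmem i j hij).1 hx
  · intro hx
    obtain ⟨i, j, hij, rfl, _⟩ := id hx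
    exact (hmem i j hij).2 hx

theorem upT_simple (n : ℕ) (hn : 1 ≤ n) (A : Finset (Fin n)) :
    (upT n A ∩ simpleC n).ncard = if A = Finset.univ then 1 else 0 := by
  have hl : n - 1 < n := by omega
  have hlast : stdB n ⟨n - 1, hl⟩ + stdB n ⟨n - 1, hl⟩ ∈ upT n A ↔ A = Finset.univ := by
    rw [mem_upT _ _ _ _ le_rfl]
    simp only [Nat.sub_self]
    have : cnt n A 0 = A.card := by simp [cnt]
    rw [this, ← Finset.card_eq_iff_eq_univ, Fintype.card_fin]
    have := Finset.card_le_univ A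
    rw [Fintype.card_fin] at this
    omega
  have hsub : ∀ x ∈ upT n A ∩ simpleC n, x = stdB n ⟨n - 1, hl⟩ + stdB n ⟨n - 1, hl⟩ := by
    rintro x ⟨⟨i, j, hij, rfl, _⟩, ⟨k, l, _, he⟩ | ⟨k, hk, he⟩⟩
    · exact (not_rootLe n i j k l hij (by rw [rootLeC, he, sub_self]; exact zero_mem _)).elim
    · have : k = ⟨n - 1, hl⟩ := Fin.ext (by simp; omega)
      subst this
      rw [he, two_smul]
  split_ifs with h
  · rw [Set.ncard_eq_one]
    refine ⟨_, Set.eq_singleton_iff_unique_mem.2 ⟨⟨hlast.2 h, ?_⟩, hsub⟩⟩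
    exact Or.inr ⟨_, by simp; omega, (two_smul _ _).symm⟩
  · have : upT n A ∩ simpleC n = ∅ := by
      rw [Set.eq_empty_iff_forall_notMem]
      intro x hx
      have := hsub x hx
      subst this
      exact h (hlast.1 hx.1)
    rw [this, Set.ncard_empty]

theorem stmt_15 (n j : ℕ) (hn : 1 ≤ n) :
    Nat.card {S : Set (Fin n → ℤ) //
        isUpperC n S ∧ (∀ a ∈ S, ∀ b ∈ S, a + b ∉ posC n) ∧ (S ∩ simpleC n).ncard = j} =
      if j = 0 then 2 ^ n - 1 else if j = 1 then 1 else 0 := by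
  have hcard : Nat.card {A : Finset (Fin n) // (if A = Finset.univ then 1 else 0) = j} =
      Nat.card {S : Set (Fin n → ℤ) //
        isUpperC n S ∧ (∀ a ∈ S, ∀ b ∈ S, a + b ∉ posC n) ∧ (S ∩ simpleC n).ncard = j} := by
    refine Nat.card_congr (Equiv.ofBijective (fun A => ⟨upT n A.1, upT_upper n A.1,
      upT_abelian n A.1, (upT_simple n hn A.1).trans A.2⟩) ⟨?_, ?_⟩)
    · intro A B h
      exact Subtype.ext (upT_inj n _ _ (congrArg Subtype.val h))
    · rintro ⟨S, h1, h2, h3⟩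
      obtain ⟨A, rfl⟩ := upT_surj n S h1 h2
      exact ⟨⟨A, (upT_simple n hn A).symm.trans h3⟩, rfl⟩
  rw [← hcard, Nat.card_eq_fintype_card, Fintype.card_subtype]
  by_cases h0 : j = 0
  · subst h0
    have : (Finset.univ.filter fun A : Finset (Fin n) =>
        (if A = Finset.univ then 1 else 0) = 0) = Finset.univ.erase Finset.univ := by
      ext A
      simp
    rw [this, Finset.card_erase_of_mem (Finset.mem_univ _)]
    simp
  · by_cases h1 : j = 1
    · subst h1
      have : (Finset.univ.filter fun A : Finset (Fin n) =>
          (if A = Finset.univ then 1 else 0) = 1) = {Finset.univ} := by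
        ext A
        simp
      rw [this]
      simp
    · simp only [h0, h1, if_false]
      rw [Finset.card_eq_zero, Finset.filter_eq_empty_iff]
      intro A _
      split_ifs <;> omega
end

section
/- For n ≥ 3, the number of abelian upper sets S of the root poset of type D_n with |S ∩ Π| = j equals: 2^n − 3 if j = 0; 3 if j = 1; and 0 if j > 1. -/
/-- standard basis vectors with natural number index -/
def ee (n i : ℕ) : Fin n → ℤ := fun k => if k.val = i then 1 else 0
def PP (n i j : ℕ) : Fin n → ℤ := ee n i + ee n j
def MM (n i j : ℕ) : Fin n → ℤ := ee n i - ee n j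

theorem stdD_eq (n : ℕ) (i : Fin n) : stdD n i = ee n i.val := by
  ext k
  simp [stdD, ee, Pi.single_apply, Fin.ext_iff]

theorem mem_posD (n : ℕ) (x : Fin n → ℤ) :
    x ∈ posD n ↔ ∃ i j : ℕ, i < j ∧ j < n ∧ (x = MM n i j ∨ x = PP n i j) := by
  constructor
  · rintro (⟨i, j, h, rfl⟩ | ⟨i, j, h, rfl⟩)
    · exact ⟨i, j, h, j.2, Or.inl (by simp [stdD_eq, MM])⟩
    · exact ⟨i, j, h, j.2, Or.inr (by simp [stdD_eq, PP])⟩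
  · rintro ⟨i, j, h, hj, rfl | rfl⟩
    · exact Or.inl ⟨⟨i, by omega⟩, ⟨j, hj⟩, h, by simp [stdD_eq, MM]⟩
    · exact Or.inr ⟨⟨i, by omega⟩, ⟨j, hj⟩, h, by simp [stdD_eq, PP]⟩

theorem mem_simpleD (n : ℕ) (hn : 3 ≤ n) (x : Fin n → ℤ) :
    x ∈ simpleD n ↔ (∃ i : ℕ, i + 1 < n ∧ x = MM n i (i + 1)) ∨ x = PP n (n - 2) (n - 1) := by
  constructor
  · rintro (⟨i, j, h, rfl⟩ | ⟨i, j, h, h', rfl⟩)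
    · exact Or.inl ⟨i, by omega, by simp [stdD_eq, MM, h]⟩
    · right
      have h1 : n - 2 = i.val := by omega
      have h2 : n - 1 = j.val := by omega
      simp [stdD_eq, PP, h1, h2]
  · rintro (⟨i, h, rfl⟩ | rfl)
    · exact Or.inl ⟨⟨i, by omega⟩, ⟨i + 1, h⟩, rfl, by simp [stdD_eq, MM]⟩
    · exact Or.inr ⟨⟨n - 2, by omega⟩, ⟨n - 1, by omega⟩, by simp; omega, by simp; omega,
        by simp [stdD_eq, PP]⟩

/-- partial sum functional -/
def cw (n k : ℕ) : (Fin n → ℤ) →+ ℤ where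
  toFun x := ∑ i : Fin n, if i.val < k then x i else 0
  map_zero' := by simp
  map_add' x y := by
    rw [← Finset.sum_add_distrib]
    refine Finset.sum_congr rfl fun i _ => ?_
    split_ifs <;> simp

theorem cw_ee (n k i : ℕ) (hi : i < n) : cw n k (ee n i) = if i < k then 1 else 0 := by
  simp only [cw, ee, AddMonoidHom.coe_mk, ZeroHom.coe_mk]
  rw [Finset.sum_eq_single (⟨i, hi⟩ : Fin n)]
  · simp
  · intro b _ hb
    have : b.val ≠ i := fun h => hb (Fin.ext h)
    simp [this]
  · simp

theorem cw_PP (n k i j : ℕ) (hi : i < n) (hj : j < n) :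
    cw n k (PP n i j) = (if i < k then 1 else 0) + (if j < k then 1 else 0) := by
  rw [PP, map_add, cw_ee n k i hi, cw_ee n k j hj]

theorem cw_MM (n k i j : ℕ) (hi : i < n) (hj : j < n) :
    cw n k (MM n i j) = (if i < k then 1 else 0) - (if j < k then 1 else 0) := by
  rw [MM, map_sub, cw_ee n k i hi, cw_ee n k j hj]

theorem cw_nonneg (n : ℕ) (hn : 3 ≤ n) (k : ℕ) (x : Fin n → ℤ)
    (hx : x ∈ AddSubmonoid.closure (simpleD n)) : 0 ≤ cw n k x := by
  induction hx using AddSubmonoid.closure_induction with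
  | mem x hx =>
    rcases (mem_simpleD n hn x).1 hx with ⟨i, hi, rfl⟩ | rfl
    · rw [cw_MM n k _ _ (by omega) hi]; split_ifs <;> omega
    · rw [cw_PP n k _ _ (by omega) (by omega)]; split_ifs <;> norm_num
  | zero => simp
  | add x y _ _ h1 h2 => rw [map_add]; omega

theorem cw_le (n : ℕ) (hn : 3 ≤ n) (k : ℕ) (a b : Fin n → ℤ) (h : rootLeD n a b) :
    cw n k a ≤ cw n k b := by
  have := cw_nonneg n hn k _ h
  rw [map_sub] at this; omega

/-- the cone -/
theorem MM_cone (n : ℕ) (hn : 3 ≤ n) (i j : ℕ) (h : i ≤ j) (hj : j < n) :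
    MM n i j ∈ AddSubmonoid.closure (simpleD n) := by
  induction j, h using Nat.le_induction with
  | base => simp [MM]
  | succ j hij ih =>
    have : MM n i (j + 1) = MM n i j + MM n j (j + 1) := by simp [MM]
    rw [this]
    exact add_mem (ih (by omega)) (AddSubmonoid.subset_closure
      ((mem_simpleD n hn _).2 (Or.inl ⟨j, hj, rfl⟩)))

theorem PP_comm (n i j : ℕ) : PP n i j = PP n j i := add_comm _ _

theorem PP_cone' (n : ℕ) (hn : 3 ≤ n) (i j : ℕ) (h : i < j) (hj : j < n) :
    PP n i j ∈ AddSubmonoid.closure (simpleD n) := by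
  have : PP n i j = MM n i (n - 2) + MM n j (n - 1) + PP n (n - 2) (n - 1) := by
    simp only [PP, MM]; abel
  rw [this]
  exact add_mem (add_mem (MM_cone n hn _ _ (by omega) (by omega))
    (MM_cone n hn _ _ (by omega) (by omega)))
    (AddSubmonoid.subset_closure ((mem_simpleD n hn _).2 (Or.inr rfl)))

theorem PP_cone (n : ℕ) (hn : 3 ≤ n) (i j : ℕ) (h : i ≠ j) (hi : i < n) (hj : j < n) :
    PP n i j ∈ AddSubmonoid.closure (simpleD n) := by
  rcases lt_or_gt_of_ne h with h | h
  · exact PP_cone' n hn i j h hj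
  · rw [PP_comm]; exact PP_cone' n hn j i h hi

theorem ee_self (n i : ℕ) (hi : i < n) : ee n i ⟨i, hi⟩ = 1 := by simp [ee]

/-- abelian upper sets -/
def GG (n : ℕ) : Set (Set (Fin n → ℤ)) :=
  {S | isUpperD n S ∧ (∀ a ∈ S, ∀ b ∈ S, a + b ∉ posD n)}

theorem PP_pos (n i j : ℕ) (h : i < j) (hj : j < n) : PP n i j ∈ posD n :=
  (mem_posD n _).2 ⟨i, j, h, hj, Or.inr rfl⟩
theorem MM_pos (n i j : ℕ) (h : i < j) (hj : j < n) : MM n i j ∈ posD n :=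
  (mem_posD n _).2 ⟨i, j, h, hj, Or.inl rfl⟩

theorem mPP {n : ℕ} (hn : 3 ≤ n) {S : Set (Fin n → ℤ)} (hS : isUpperD n S)
    {i j i' j' : ℕ} (h : PP n i j ∈ S) (hi : i < n) (hj : j < n) (h1 : i' ≤ i)
    (h2 : j' ≤ j) (h3 : i' < j') : PP n i' j' ∈ S := by
  refine hS.2 _ h _ (PP_pos n _ _ h3 (by omega)) ?_
  have : PP n i' j' - PP n i j = MM n i' i + MM n j' j := by simp only [PP, MM]; abel
  rw [rootLeD, this]
  exact add_mem (MM_cone n hn _ _ h1 hi) (MM_cone n hn _ _ h2 hj)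

theorem mMM {n : ℕ} (hn : 3 ≤ n) {S : Set (Fin n → ℤ)} (hS : isUpperD n S)
    {i j i' j' : ℕ} (h : MM n i j ∈ S) (hi : i < n) (hj : j' < n) (h1 : i' ≤ i)
    (h2 : j ≤ j') (h3 : i' < j') : MM n i' j' ∈ S := by
  refine hS.2 _ h _ (MM_pos n _ _ h3 (by omega)) ?_
  have : MM n i' j' - MM n i j = MM n i' i + MM n j j' := by simp only [MM]; abel
  rw [rootLeD, this]
  exact add_mem (MM_cone n hn _ _ h1 hi) (MM_cone n hn _ _ h2 hj)

theorem mMP {n : ℕ} (hn : 3 ≤ n) {S : Set (Fin n → ℤ)} (hS : isUpperD n S)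
    {i j i' j' : ℕ} (h : MM n i j ∈ S) (hi : i < n) (hj : j < n) (h1 : i' ≤ i)
    (h2 : j ≠ j') (hj' : j' < n) (h3 : i' < j') : PP n i' j' ∈ S := by
  refine hS.2 _ h _ (PP_pos n _ _ h3 (by omega)) ?_
  have : PP n i' j' - MM n i j = MM n i' i + PP n j j' := by simp only [PP, MM]; abel
  rw [rootLeD, this]
  exact add_mem (MM_cone n hn _ _ h1 hi) (PP_cone n hn _ _ h2 hj hj')

theorem PP_inj (n i j p q : ℕ) (h : i < j) (hj : j < n) (h' : p < q) (hq : q < n)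
    (he : PP n i j = PP n p q) : i = p ∧ j = q := by
  have e := fun k => congrArg (cw n k) he
  simp only [cw_PP n _ i j (by omega) hj, cw_PP n _ p q (by omega) hq] at e
  have e0 : i = p := by
    rcases lt_trichotomy i p with h1 | h1 | h1
    · have := e (i + 1); split_ifs at this <;> omega
    · exact h1
    · have := e (p + 1); split_ifs at this <;> omega
  refine ⟨e0, ?_⟩
  rcases lt_trichotomy j q with h1 | h1 | h1
  · have := e (j + 1); split_ifs at this <;> omega
  · exact h1
  · have := e (q + 1); split_ifs at this <;> omega

theorem MM_inj (n i j p q : ℕ) (h : i < j) (hj : j < n) (h' : p < q) (hq : q < n)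
    (he : MM n i j = MM n p q) : i = p ∧ j = q := by
  have e := fun k => congrArg (cw n k) he
  simp only [cw_MM n _ i j (by omega) hj, cw_MM n _ p q (by omega) hq] at e
  have e0 : i = p := by
    rcases lt_trichotomy i p with h1 | h1 | h1
    · have := e (i + 1); split_ifs at this <;> omega
    · exact h1
    · have := e (p + 1); split_ifs at this <;> omega
  refine ⟨e0, ?_⟩
  rcases lt_trichotomy j q with h1 | h1 | h1
  · have := e (j + 1); split_ifs at this <;> omega
  · exact h1
  · have := e (q + 1); split_ifs at this <;> omega

theorem sum_PP (n i j : ℕ) (hi : i < n) (hj : j < n) : cw n n (PP n i j) = 2 := by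
  rw [cw_PP n n i j hi hj]; simp [hi, hj]
theorem sum_MM (n i j : ℕ) (hi : i < n) (hj : j < n) : cw n n (MM n i j) = 0 := by
  rw [cw_MM n n i j hi hj]; simp [hi, hj]

/-- shifted graphs on the interval from `a` to `b` -/
def FF (a b : ℕ) : Set (ℕ → ℕ → Prop) :=
  {Q | (∀ i j, Q i j → a ≤ i ∧ i < j ∧ j < b) ∧
    ∀ i j i' j', Q i j → a ≤ i' → i' ≤ i → j' ≤ j → i' < j' → Q i' j'}

theorem FF_triv (a b : ℕ) (h : b ≤ a + 1) : FF a b = {fun _ _ => False} := by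
  ext Q
  simp only [FF, Set.mem_ofPred_eq, Set.mem_singleton_iff]
  constructor
  · rintro ⟨h1, -⟩
    ext i j
    simp only [iff_false]
    intro hq
    have := h1 i j hq
    omega
  · rintro rfl; simp

theorem FF_rec (a b : ℕ) (h : a + 1 < b) : (FF a b).encard =
    (FF a (b - 1)).encard + (FF (a + 1) b).encard := by
  have key : FF a b = FF a (b - 1) ∪
      (fun (Q : ℕ → ℕ → Prop) i j => (i = a ∧ a < j ∧ j < b) ∨ Q i j) '' FF (a + 1) b := by
    ext Q
    constructor
    · rintro ⟨h1, h2⟩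
      by_cases hq : Q a (b - 1)
      · right
        refine ⟨fun i j => a < i ∧ Q i j, ⟨?_, ?_⟩, ?_⟩
        · rintro i j ⟨h3, h4⟩
          have := h1 i j h4
          omega
        · rintro i j i' j' ⟨h3, h4⟩ h5 h6 h7 h8
          exact ⟨h5, h2 i j i' j' h4 (by omega) h6 h7 h8⟩
        · ext i j
          constructor
          · rintro (⟨rfl, h3, h4⟩ | h3)
            · exact h2 _ _ _ _ hq le_rfl le_rfl (by omega) h3
            · exact h3.2
          · intro h3
            have := h1 i j h3
            by_cases hi : i = a
            · left; omega
            · right; exact ⟨by omega, h3⟩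
      · left
        refine ⟨fun i j hij => ?_, h2⟩
        have h3 := h1 i j hij
        refine ⟨h3.1, h3.2.1, ?_⟩
        by_contra hc
        exact hq (h2 i j a (b - 1) hij le_rfl h3.1 (by omega) (by omega))
    · rintro (⟨h1, h2⟩ | ⟨Q, ⟨h1, h2⟩, rfl⟩)
      · refine ⟨fun i j hij => ?_, h2⟩
        have := h1 i j hij
        omega
      · refine ⟨?_, ?_⟩
        · rintro i j (h3 | h3)
          · omega
          · have := h1 i j h3; omega
        · rintro i j i' j' (h3 | h3) h4 h5 h6 h7
          · left; omega
          · have := h1 i j h3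
            by_cases hi : i' = a
            · left; omega
            · right; exact h2 i j i' j' h3 (by omega) h5 h6 h7
  rw [key, Set.encard_union_eq, Set.InjOn.encard_image]
  · rintro Q hQ R hR hQR
    ext i j
    have := congrFun (congrFun hQR i) j
    simp only [eq_iff_iff] at this
    constructor
    · intro h3
      have := hQ.1 i j h3
      have h4 : ¬ (i = a ∧ a < j ∧ j < b) := by omega
      tauto
    · intro h3
      have := hR.1 i j h3
      have h4 : ¬ (i = a ∧ a < j ∧ j < b) := by omega
      tauto
  · rw [Set.disjoint_left]
    rintro _ h1 ⟨Q, hQ, rfl⟩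
    have := h1.1 a (b - 1) (Or.inl (by omega))
    omega

theorem FF_card (m : ℕ) : ∀ a b, b - a - 1 = m → (FF a b).encard = 2 ^ m := by
  induction m with
  | zero => intro a b h; rw [FF_triv a b (by omega)]; simp
  | succ m ih =>
    intro a b h
    rw [FF_rec a b (by omega), ih _ _ (by omega), ih _ _ (by omega), pow_succ, mul_two]

def YY (m : ℕ) : Set (ℕ × (ℕ → ℕ → Prop)) := {p | 1 ≤ p.1 ∧ p.1 ≤ m ∧ p.2 ∈ FF 1 p.1}

theorem YY_card (m : ℕ) : (YY (m + 1)).encard = 2 ^ m := by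
  induction m with
  | zero =>
    have : YY (0 + 1) = {(1, fun _ _ => False)} := by
      ext ⟨l, Q⟩
      simp only [YY, Set.mem_ofPred_eq, Set.mem_singleton_iff, Prod.mk.injEq]
      constructor
      · rintro ⟨h1, h2, h3⟩
        have : l = 1 := by omega
        subst this
        rw [FF_triv 1 1 (by omega)] at h3
        exact ⟨rfl, h3⟩
      · rintro ⟨rfl, rfl⟩
        rw [FF_triv 1 1 (by omega)]
        simp
    rw [this]; simp
  | succ m ih =>
    have : YY (m + 1 + 1) = YY (m + 1) ∪ (fun Q => (m + 2, Q)) '' FF 1 (m + 2) := by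
      ext ⟨l, Q⟩
      simp only [YY, Set.mem_ofPred_eq, Set.mem_union, Set.mem_image, Prod.mk.injEq]
      constructor
      · rintro ⟨h1, h2, h3⟩
        by_cases hl : l = m + 2
        · subst hl; right; exact ⟨Q, h3, rfl, rfl⟩
        · left; exact ⟨h1, by omega, h3⟩
      · rintro (⟨h1, h2, h3⟩ | ⟨Q, h3, rfl, rfl⟩)
        · exact ⟨h1, by omega, h3⟩
        · exact ⟨by omega, by omega, h3⟩
    rw [this, Set.encard_union_eq, ih, Set.InjOn.encard_image, FF_card m _ _ (by omega), pow_succ,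
      mul_two]
    · intro Q _ R _ h; simpa using h
    · rw [Set.disjoint_left]
      rintro _ h1 ⟨Q, hQ, rfl⟩
      have := h1.2.1
      simp at this

/-- the diagram automorphism negating the last coordinate -/
def sg (n : ℕ) : (Fin n → ℤ) →+ (Fin n → ℤ) where
  toFun x := fun k => if k.val = n - 1 then - x k else x k
  map_zero' := by ext k; simp
  map_add' x y := by
    ext k
    simp only [Pi.add_apply]
    split_ifs <;> omega

theorem sg_sg (n : ℕ) (x : Fin n → ℤ) : sg n (sg n x) = x := by
  ext k
  simp only [sg, AddMonoidHom.coe_mk, ZeroHom.coe_mk]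
  split_ifs <;> simp

theorem sg_ee (n i : ℕ) (h : i ≠ n - 1) : sg n (ee n i) = ee n i := by
  ext k
  simp only [sg, AddMonoidHom.coe_mk, ZeroHom.coe_mk, ee]
  split_ifs <;> omega

theorem sg_last (n : ℕ) : sg n (ee n (n - 1)) = - ee n (n - 1) := by
  ext k
  simp only [sg, AddMonoidHom.coe_mk, ZeroHom.coe_mk, ee, Pi.neg_apply]
  split_ifs <;> omega

theorem sg_PP (n i j : ℕ) (hi : i ≠ n - 1) (hj : j ≠ n - 1) : sg n (PP n i j) = PP n i j := by
  rw [PP, map_add, sg_ee n i hi, sg_ee n j hj]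
theorem sg_MM (n i j : ℕ) (hi : i ≠ n - 1) (hj : j ≠ n - 1) : sg n (MM n i j) = MM n i j := by
  rw [MM, map_sub, sg_ee n i hi, sg_ee n j hj]
theorem sg_PP_last (n i : ℕ) (hi : i ≠ n - 1) : sg n (PP n i (n - 1)) = MM n i (n - 1) := by
  rw [PP, map_add, sg_ee n i hi, sg_last, MM, sub_eq_add_neg]
theorem sg_MM_last (n i : ℕ) (hi : i ≠ n - 1) : sg n (MM n i (n - 1)) = PP n i (n - 1) := by
  rw [MM, map_sub, sg_ee n i hi, sg_last, PP, sub_neg_eq_add]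

theorem sg_pos (n : ℕ) (x : Fin n → ℤ) (hx : x ∈ posD n) : sg n x ∈ posD n := by
  rcases (mem_posD n x).1 hx with ⟨i, j, hij, hj, rfl | rfl⟩
  · by_cases h : j = n - 1
    · subst h; rw [sg_MM_last n i (by omega)]; exact PP_pos n _ _ hij hj
    · rw [sg_MM n i j (by omega) h]; exact MM_pos n _ _ hij hj
  · by_cases h : j = n - 1
    · subst h; rw [sg_PP_last n i (by omega)]; exact MM_pos n _ _ hij hj
    · rw [sg_PP n i j (by omega) h]; exact PP_pos n _ _ hij hj

theorem sg_pos_iff (n : ℕ) (x : Fin n → ℤ) : sg n x ∈ posD n ↔ x ∈ posD n :=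
  ⟨fun h => by have := sg_pos n _ h; rwa [sg_sg] at this, sg_pos n x⟩

theorem sg_simple (n : ℕ) (hn : 3 ≤ n) (x : Fin n → ℤ) (hx : x ∈ simpleD n) :
    sg n x ∈ simpleD n := by
  rw [mem_simpleD n hn] at hx ⊢
  rcases hx with ⟨i, hi, rfl⟩ | rfl
  · by_cases h : i + 1 = n - 1
    · have h2 : n - 2 = i := by omega
      right
      rw [h, sg_MM_last n i (by omega), h2]
    · left
      exact ⟨i, hi, sg_MM n _ _ (by omega) h⟩
  · left
    refine ⟨n - 2, by omega, ?_⟩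
    rw [sg_PP_last n _ (by omega)]
    congr 1; omega

theorem sg_simple_iff (n : ℕ) (hn : 3 ≤ n) (x : Fin n → ℤ) : sg n x ∈ simpleD n ↔ x ∈ simpleD n :=
  ⟨fun h => by have := sg_simple n hn _ h; rwa [sg_sg] at this, sg_simple n hn x⟩

theorem sg_cone (n : ℕ) (hn : 3 ≤ n) (x : Fin n → ℤ)
    (hx : x ∈ AddSubmonoid.closure (simpleD n)) :
    sg n x ∈ AddSubmonoid.closure (simpleD n) := by
  induction hx using AddSubmonoid.closure_induction with
  | mem x hx => exact AddSubmonoid.subset_closure (sg_simple n hn x hx)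
  | zero => simp
  | add x y _ _ h1 h2 => rw [map_add]; exact add_mem h1 h2

theorem sg_GG (n : ℕ) (hn : 3 ≤ n) (S : Set (Fin n → ℤ)) (hS : S ∈ GG n) :
    sg n ⁻¹' S ∈ GG n := by
  obtain ⟨⟨h1, h2⟩, h3⟩ := hS
  refine ⟨⟨fun x hx => (sg_pos_iff n x).1 (h1 hx), ?_⟩, ?_⟩
  · intro a ha b hb hab
    refine h2 _ ha _ (sg_pos n b hb) ?_
    rw [rootLeD, ← map_sub]
    exact sg_cone n hn _ hab
  · intro a ha b hb hab
    apply h3 _ ha _ hb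
    rw [← map_add]
    exact sg_pos n _ hab

theorem sg_pre (n : ℕ) (S : Set (Fin n → ℤ)) : sg n ⁻¹' (sg n ⁻¹' S) = S := by
  ext x; simp [sg_sg]

def X1 (n : ℕ) : Set (Set (Fin n → ℤ)) := {S | S ∈ GG n ∧ ∀ x ∈ S, cw n n x = 2}
def X2 (n : ℕ) : Set (Set (Fin n → ℤ)) := {S | S ∈ GG n ∧ ∀ x ∈ S, cw n n (sg n x) = 2}
def X3 (n : ℕ) : Set (Set (Fin n → ℤ)) := {S | S ∈ GG n ∧ S ∉ X1 n ∧ S ∉ X2 n}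

theorem X2_iff (n : ℕ) (hn : 3 ≤ n) (S : Set (Fin n → ℤ)) : S ∈ X2 n ↔ sg n ⁻¹' S ∈ X1 n := by
  constructor
  · rintro ⟨h1, h2⟩
    refine ⟨sg_GG n hn S h1, fun x hx => ?_⟩
    have := h2 _ hx
    rwa [sg_sg] at this
  · rintro ⟨h1, h2⟩
    refine ⟨?_, fun x hx => ?_⟩
    · have := sg_GG n hn _ h1
      rwa [sg_pre] at this
    · apply h2
      simpa [sg_sg] using hx

theorem X2_image (n : ℕ) (hn : 3 ≤ n) : X2 n = (fun S => sg n ⁻¹' S) '' X1 n := by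
  ext S
  rw [X2_iff n hn]
  constructor
  · intro h; exact ⟨_, h, sg_pre n S⟩
  · rintro ⟨T, hT, rfl⟩
    simpa only [sg_pre] using hT

theorem X2_card (n : ℕ) (hn : 3 ≤ n) : (X2 n).encard = (X1 n).encard := by
  rw [X2_image n hn, Set.InjOn.encard_image]
  intro S _ T _ h
  have : sg n ⁻¹' (sg n ⁻¹' S) = sg n ⁻¹' (sg n ⁻¹' T) := congrArg (fun S => sg n ⁻¹' S) h
  rwa [sg_pre, sg_pre] at this

def setP (n : ℕ) (Q : ℕ → ℕ → Prop) : Set (Fin n → ℤ) := {x | ∃ i j, Q i j ∧ x = PP n i j}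

theorem mem_setP (n : ℕ) (Q : ℕ → ℕ → Prop) (a : ℕ) (hQ : Q ∈ FF a n) (i j : ℕ) (hij : i < j)
    (hj : j < n) : PP n i j ∈ setP n Q ↔ Q i j := by
  constructor
  · rintro ⟨p, q, h1, h2⟩
    have h3 := hQ.1 p q h1
    obtain ⟨rfl, rfl⟩ := PP_inj n i j p q hij hj h3.2.1 h3.2.2 h2
    exact h1
  · intro h; exact ⟨i, j, h, rfl⟩

theorem FF_mono (a b c : ℕ) (h : b ≤ c) (Q) (hQ : Q ∈ FF a b) : Q ∈ FF a c := by
  refine ⟨fun i j hij => ?_, hQ.2⟩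
  have := hQ.1 i j hij
  omega

theorem le_PP_PP (n : ℕ) (hn : 3 ≤ n) (i j p q : ℕ) (hij : i < j) (hj : j < n) (hpq : p < q)
    (hq : q < n) (h : rootLeD n (PP n i j) (PP n p q)) : p ≤ i ∧ q ≤ j := by
  have e := fun k => cw_le n hn k _ _ h
  simp only [cw_PP n _ i j (by omega) hj, cw_PP n _ p q (by omega) hq] at e
  constructor
  · have := e (i + 1); split_ifs at this <;> omega
  · have := e (j + 1); split_ifs at this <;> omega

theorem le_PP_MM (n : ℕ) (hn : 3 ≤ n) (i j p q : ℕ) (hij : i < j) (hj : j < n) (hpq : p < q)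
    (hq : q < n) (h : rootLeD n (PP n i j) (MM n p q)) : False := by
  have e := cw_le n hn n _ _ h
  rw [sum_PP n i j (by omega) hj, sum_MM n p q (by omega) hq] at e
  omega

theorem le_MM_PP (n : ℕ) (hn : 3 ≤ n) (i j p q : ℕ) (hij : i < j) (hj : j < n) (hpq : p < q)
    (hq : q < n) (h : rootLeD n (MM n i j) (PP n p q)) : p ≤ i := by
  have e := cw_le n hn (i + 1) _ _ h
  rw [cw_MM n _ i j (by omega) hj, cw_PP n _ p q (by omega) hq] at e
  split_ifs at e <;> omega

theorem le_MM_MM (n : ℕ) (hn : 3 ≤ n) (i j p q : ℕ) (hij : i < j) (hj : j < n) (hpq : p < q)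
    (hq : q < n) (h : rootLeD n (MM n i j) (MM n p q)) : p ≤ i ∧ j ≤ q := by
  have e := fun k => cw_le n hn k _ _ h
  simp only [cw_MM n _ i j (by omega) hj, cw_MM n _ p q (by omega) hq] at e
  have h1 : p ≤ i := by have := e (i + 1); split_ifs at this <;> omega
  refine ⟨h1, ?_⟩
  by_contra hc
  have e1 := e (q + 1)
  have e2 := e (i + 1)
  split_ifs at e1 e2 <;> omega

theorem pos_sum (n : ℕ) (x : Fin n → ℤ) (hx : x ∈ posD n) : cw n n x ≤ 2 := by
  rcases (mem_posD n x).1 hx with ⟨i, j, hij, hj, rfl | rfl⟩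
  · rw [sum_MM n i j (by omega) hj]; omega
  · rw [sum_PP n i j (by omega) hj]

theorem pos_coord (n : ℕ) (x : Fin n → ℤ) (hx : x ∈ posD n) (k : Fin n) : x k ≤ 1 := by
  rcases (mem_posD n x).1 hx with ⟨i, j, hij, hj, rfl | rfl⟩
  · simp only [MM, ee, Pi.sub_apply]; split_ifs <;> omega
  · simp only [PP, ee, Pi.add_apply]; split_ifs <;> omega

theorem X1_eq (n : ℕ) (hn : 3 ≤ n) : X1 n = setP n '' FF 0 n := by
  ext S
  constructor
  · rintro ⟨⟨h1, h3⟩, h2⟩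
    refine ⟨fun i j => i < j ∧ j < n ∧ PP n i j ∈ S, ⟨?_, ?_⟩, ?_⟩
    · rintro i j ⟨h4, h5, h6⟩; omega
    · rintro i j i' j' ⟨h4, h5, h6⟩ h7 h8 h9 h10
      exact ⟨h10, by omega, mPP hn h1 h6 (by omega) h5 h8 h9 h10⟩
    · ext x
      constructor
      · rintro ⟨i, j, ⟨-, -, h⟩, rfl⟩; exact h
      · intro hx
        rcases (mem_posD n x).1 (h1.1 hx) with ⟨i, j, hij, hj, rfl | rfl⟩
        · have := h2 _ hx
          rw [sum_MM n i j (by omega) hj] at this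
          omega
        · exact ⟨i, j, ⟨hij, hj, hx⟩, rfl⟩
  · rintro ⟨Q, hQ, rfl⟩
    have hsum : ∀ x ∈ setP n Q, cw n n x = 2 := by
      rintro x ⟨i, j, h, rfl⟩
      have := hQ.1 i j h
      exact sum_PP n i j (by omega) (by omega)
    refine ⟨⟨⟨?_, ?_⟩, ?_⟩, hsum⟩
    · rintro x ⟨i, j, h, rfl⟩
      have := hQ.1 i j h
      exact PP_pos n i j (by omega) (by omega)
    · rintro x ⟨i, j, h, rfl⟩ b hb hab
      have hh := hQ.1 i j h
      rcases (mem_posD n b).1 hb with ⟨p, q, hpq, hq, rfl | rfl⟩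
      · exact (le_PP_MM n hn i j p q (by omega) (by omega) hpq hq hab).elim
      · have := le_PP_PP n hn i j p q (by omega) (by omega) hpq hq hab
        exact ⟨p, q, hQ.2 i j p q h (by omega) this.1 this.2 hpq, rfl⟩
    · intro a ha b hb hab
      have := pos_sum n _ hab
      rw [map_add, hsum a ha, hsum b hb] at this
      omega

theorem setP_inj (n : ℕ) : Set.InjOn (setP n) (FF 0 n) := by
  intro Q hQ R hR h
  ext i j
  by_cases hij : i < j ∧ j < n
  · rw [← mem_setP n Q 0 hQ i j hij.1 hij.2, ← mem_setP n R 0 hR i j hij.1 hij.2, h]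
  · constructor
    · intro h1; exact (hij (hQ.1 i j h1).2).elim
    · intro h1; exact (hij (hR.1 i j h1).2).elim

theorem X1_card (n : ℕ) (hn : 3 ≤ n) : (X1 n).encard = 2 ^ (n - 1) := by
  rw [X1_eq n hn, (setP_inj n).encard_image, FF_card (n - 1) 0 n (by omega)]

theorem X12_eq (n : ℕ) (hn : 3 ≤ n) : X1 n ∩ X2 n = setP n '' FF 0 (n - 1) := by
  ext S
  constructor
  · rintro ⟨h1, h2⟩
    rw [X1_eq n hn] at h1
    obtain ⟨Q, hQ, rfl⟩ := h1
    refine ⟨Q, ⟨fun i j hij => ?_, hQ.2⟩, rfl⟩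
    have hh := hQ.1 i j hij
    refine ⟨hh.1, hh.2.1, ?_⟩
    by_contra hc
    have hj : j = n - 1 := by omega
    subst hj
    have := h2.2 _ ⟨i, _, hij, rfl⟩
    rw [sg_PP_last n i (by omega), sum_MM n _ _ (by omega) (by omega)] at this
    omega
  · rintro ⟨Q, hQ, rfl⟩
    have h1 : setP n Q ∈ X1 n := by
      rw [X1_eq n hn]
      exact ⟨Q, FF_mono _ _ _ (by omega) Q hQ, rfl⟩
    refine ⟨h1, h1.1, ?_⟩
    rintro x ⟨i, j, hij, rfl⟩
    have hh := hQ.1 i j hij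
    rw [sg_PP n i j (by omega) (by omega)]
    exact sum_PP n i j (by omega) (by omega)

theorem X12_card (n : ℕ) (hn : 3 ≤ n) : (X1 n ∩ X2 n).encard = 2 ^ (n - 2) := by
  rw [X12_eq n hn, Set.InjOn.encard_image, FF_card (n - 2) 0 (n - 1) (by omega)]
  exact (setP_inj n).mono fun Q hQ => FF_mono _ _ _ (by omega) Q hQ

def setY (n : ℕ) (y : ℕ × (ℕ → ℕ → Prop)) : Set (Fin n → ℤ) :=
  {x | (∃ j, 0 < j ∧ j < n ∧ x = PP n 0 j) ∨ (∃ j, y.1 ≤ j ∧ j < n ∧ x = MM n 0 j) ∨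
    ∃ i j, y.2 i j ∧ x = PP n i j}

theorem PP_ne_MM (n i j p q : ℕ) (hi : i < n) (hj : j < n) (hp : p < n) (hq : q < n) :
    PP n i j ≠ MM n p q := by
  intro h
  have := congrArg (cw n n) h
  rw [sum_PP n i j hi hj, sum_MM n p q hp hq] at this
  omega

theorem mem_setY_MM (n l : ℕ) (Q : ℕ → ℕ → Prop) (hl : 1 ≤ l) (hln : l ≤ n - 1)
    (hQ : Q ∈ FF 1 l) (i j : ℕ) (hij : i < j) (hj : j < n) :
    MM n i j ∈ setY n (l, Q) ↔ i = 0 ∧ l ≤ j := by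
  constructor
  · rintro (⟨q, h1, h2, h3⟩ | ⟨q, h1, h2, h3⟩ | ⟨p, q, h1, h3⟩)
    · exact (PP_ne_MM n _ _ _ _ (by omega) (by omega) (by omega) (by omega) h3.symm).elim
    · simp only at h1
      obtain ⟨rfl, rfl⟩ := MM_inj n i j 0 q hij hj (by omega) h2 h3
      exact ⟨rfl, h1⟩
    · have := hQ.1 p q h1
      exact (PP_ne_MM n _ _ _ _ (by omega) (by omega) (by omega) (by omega) h3.symm).elim
  · rintro ⟨rfl, h⟩
    exact Or.inr (Or.inl ⟨j, h, hj, rfl⟩)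

theorem mem_setY_PP (n l : ℕ) (Q : ℕ → ℕ → Prop) (hl : 1 ≤ l) (hln : l ≤ n - 1)
    (hQ : Q ∈ FF 1 l) (i j : ℕ) (hij : i < j) (hj : j < n) :
    PP n i j ∈ setY n (l, Q) ↔ i = 0 ∨ Q i j := by
  constructor
  · rintro (⟨q, h1, h2, h3⟩ | ⟨q, h1, h2, h3⟩ | ⟨p, q, h1, h3⟩)
    · exact Or.inl (PP_inj n i j 0 q hij hj h1 h2 h3).1
    · exact (PP_ne_MM n _ _ _ _ (by omega) (by omega) (by omega) (by omega) h3).elim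
    · have := hQ.1 p q h1
      obtain ⟨rfl, rfl⟩ := PP_inj n i j p q hij hj (by omega) (by omega) h3
      exact Or.inr h1
  · rintro (rfl | h)
    · exact Or.inl ⟨j, hij, hj, rfl⟩
    · exact Or.inr (Or.inr ⟨i, j, h, rfl⟩)

theorem setY_inj (n : ℕ) (hn : 3 ≤ n) : Set.InjOn (setY n) (YY (n - 1)) := by
  rintro ⟨l, Q⟩ ⟨h1, h2, hQ⟩ ⟨m, R⟩ ⟨h1', h2', hR⟩ h
  simp only at h1 h2 hQ h1' h2' hR
  have hlm : l = m := by
    have e1 := mem_setY_MM n l Q h1 h2 hQ 0 l (by omega) (by omega)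
    have e2 := mem_setY_MM n m R h1' h2' hR 0 l (by omega) (by omega)
    have e3 := mem_setY_MM n l Q h1 h2 hQ 0 m (by omega) (by omega)
    have e4 := mem_setY_MM n m R h1' h2' hR 0 m (by omega) (by omega)
    rw [h] at e1 e3
    have h5 := e2.1 (e1.2 ⟨rfl, le_rfl⟩)
    have h6 := e3.1 (e4.2 ⟨rfl, le_rfl⟩)
    omega
  subst hlm
  rw [Prod.mk.injEq]
  refine ⟨rfl, ?_⟩
  ext i j
  constructor
  · intro hq
    have hh := hQ.1 i j hq
    have := (mem_setY_PP n l Q h1 h2 hQ i j (by omega) (by omega)).2 (Or.inr hq)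
    rw [h, mem_setY_PP n l R h1 h2 hR i j (by omega) (by omega)] at this
    exact this.resolve_left (by omega)
  · intro hq
    have hh := hR.1 i j hq
    have := (mem_setY_PP n l R h1 h2 hR i j (by omega) (by omega)).2 (Or.inr hq)
    rw [← h, mem_setY_PP n l Q h1 h2 hQ i j (by omega) (by omega)] at this
    exact this.resolve_left (by omega)

theorem setY_GG (n : ℕ) (hn : 3 ≤ n) (l : ℕ) (Q : ℕ → ℕ → Prop) (h1 : 1 ≤ l) (h2 : l ≤ n - 1)
    (hQ : Q ∈ FF 1 l) : setY n (l, Q) ∈ GG n := by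
  have hpos : setY n (l, Q) ⊆ posD n := by
    rintro x (⟨q, h3, h4, rfl⟩ | ⟨q, h3, h4, rfl⟩ | ⟨p, q, h3, rfl⟩)
    · exact PP_pos n _ _ h3 h4
    · simp only at h3
      exact MM_pos n _ _ (by omega) h4
    · have := hQ.1 p q h3
      exact PP_pos n _ _ (by omega) (by omega)
  refine ⟨⟨hpos, ?_⟩, ?_⟩
  · intro a ha b hb hab
    rcases (mem_posD n a).1 (hpos ha) with ⟨i, j, hij, hj, rfl | rfl⟩
    · rw [mem_setY_MM n l Q h1 h2 hQ i j hij hj] at ha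
      rcases (mem_posD n b).1 hb with ⟨p, q, hpq, hq, rfl | rfl⟩
      · rw [mem_setY_MM n l Q h1 h2 hQ p q hpq hq]
        have := le_MM_MM n hn i j p q hij hj hpq hq hab
        omega
      · rw [mem_setY_PP n l Q h1 h2 hQ p q hpq hq]
        have := le_MM_PP n hn i j p q hij hj hpq hq hab
        omega
    · rw [mem_setY_PP n l Q h1 h2 hQ i j hij hj] at ha
      rcases (mem_posD n b).1 hb with ⟨p, q, hpq, hq, rfl | rfl⟩
      · exact (le_PP_MM n hn i j p q hij hj hpq hq hab).elim
      · rw [mem_setY_PP n l Q h1 h2 hQ p q hpq hq]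
        have := le_PP_PP n hn i j p q hij hj hpq hq hab
        by_cases hp : p = 0
        · exact Or.inl hp
        · right
          exact hQ.2 i j p q (ha.resolve_left (by omega)) (by omega) this.1 this.2 hpq
  · skip
    have mixed : ∀ i j p q, i < j → j < n → p < q → q < n → MM n i j ∈ setY n (l, Q) →
        PP n p q ∈ setY n (l, Q) → MM n i j + PP n p q ∉ posD n := by
      intro i j p q hij hj hpq hq ha hb hab
      rw [mem_setY_MM n l Q h1 h2 hQ i j hij hj] at ha
      rw [mem_setY_PP n l Q h1 h2 hQ p q hpq hq] at hb
      obtain ⟨rfl, hlj⟩ := ha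
      rcases hb with rfl | hb
      · have := pos_coord n _ hab ⟨0, by omega⟩
        simp only [MM, PP, ee, Pi.sub_apply, Pi.add_apply] at this
        split_ifs at this <;> omega
      · have hh := hQ.1 p q hb
        rcases (mem_posD n _).1 hab with ⟨u, v, huv, hv, he | he⟩
        · have := congrArg (cw n n) he
          rw [map_add, sum_MM n 0 j (by omega) hj, sum_PP n p q (by omega) hq,
            sum_MM n u v (by omega) hv] at this
          omega
        · have := congrFun he ⟨j, hj⟩
          simp only [MM, PP, ee, Pi.sub_apply, Pi.add_apply] at this
          split_ifs at this <;> omega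
    intro a ha b hb
    rcases (mem_posD n a).1 (hpos ha) with ⟨i, j, hij, hj, rfl | rfl⟩ <;>
      rcases (mem_posD n b).1 (hpos hb) with ⟨p, q, hpq, hq, rfl | rfl⟩
    · rw [mem_setY_MM n l Q h1 h2 hQ i j hij hj] at ha
      rw [mem_setY_MM n l Q h1 h2 hQ p q hpq hq] at hb
      intro hab
      have := pos_coord n _ hab ⟨0, by omega⟩
      simp only [MM, ee, Pi.sub_apply, Pi.add_apply] at this
      split_ifs at this <;> omega
    · exact mixed i j p q hij hj hpq hq ha hb
    · rw [add_comm]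
      exact mixed p q i j hpq hq hij hj hb ha
    · intro hab
      have := pos_sum n _ hab
      rw [map_add, sum_PP n i j (by omega) hj, sum_PP n p q (by omega) hq] at this
      omega

theorem X3_eq (n : ℕ) (hn : 3 ≤ n) : X3 n = setY n '' YY (n - 1) := by
  classical
  ext S
  constructor
  · rintro ⟨hG, hX1, hX2⟩
    have hG' := hG
    obtain ⟨hU, hA⟩ := hG'
    have e1 : ∃ i j, i < j ∧ j < n ∧ MM n i j ∈ S := by
      by_contra hc
      push Not at hc
      refine hX1 ⟨hG, fun x hx => ?_⟩
      rcases (mem_posD n x).1 (hU.1 hx) with ⟨i, j, hij, hj, rfl | rfl⟩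
      · exact (hc i j hij hj hx).elim
      · exact sum_PP n i j (by omega) hj
    obtain ⟨i, j, hij, hj, hM⟩ := e1
    have hM0 : MM n 0 (n - 1) ∈ S :=
      mMM hn hU hM (by omega) (by omega) (by omega) (by omega) (by omega)
    have hP0 : PP n 0 (n - 1) ∈ S := by
      by_contra hc
      refine hX2 ⟨hG, fun x hx => ?_⟩
      rcases (mem_posD n x).1 (hU.1 hx) with ⟨p, q, hpq, hq, rfl | rfl⟩
      · by_cases hqn : q = n - 1
        · subst hqn
          rw [sg_MM_last n p (by omega)]
          exact sum_PP n _ _ (by omega) (by omega)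
        · exact (hc (mMP hn hU hx (by omega) (by omega) (by omega) hqn (by omega)
            (by omega))).elim
      · by_cases hqn : q = n - 1
        · subst hqn
          exact (hc (mPP hn hU hx (by omega) (by omega) (by omega) (by omega) (by omega))).elim
        · rw [sg_PP n p q (by omega) hqn]
          exact sum_PP n _ _ (by omega) (by omega)
    have hex : ∃ l, 0 < l ∧ MM n 0 l ∈ S := ⟨n - 1, by omega, hM0⟩
    obtain ⟨hl0, hlS⟩ := Nat.find_spec hex
    have hmin := fun m => Nat.find_min (H := hex) (m := m)
    have hle := Nat.find_min' hex ⟨by omega, hM0⟩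
    generalize Nat.find hex = l at *
    refine ⟨(l, fun i j => 1 ≤ i ∧ i < j ∧ j < l ∧ PP n i j ∈ S), ⟨hl0, hle, ?_, ?_⟩, ?_⟩
    · rintro p q ⟨h1, h2, h3, h4⟩; exact ⟨h1, h2, h3⟩
    · rintro p q p' q' ⟨h1, h2, h3, h4⟩ h5 h6 h7 h8
      exact ⟨h5, h8, by omega, mPP hn hU h4 (by omega) (by omega) h6 h7 h8⟩
    · ext x
      constructor
      · rintro (⟨q, h1, h2, rfl⟩ | ⟨q, h1, h2, rfl⟩ | ⟨p, q, ⟨-, -, -, h1⟩, rfl⟩)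
        · exact mPP hn hU hP0 (by omega) (by omega) (by omega) (by omega) h1
        · simp only at h1
          exact mMM hn hU hlS (by omega) (by omega) (by omega) (by omega) (by omega)
        · exact h1
      · intro hx
        rcases (mem_posD n x).1 (hU.1 hx) with ⟨p, q, hpq, hq, rfl | rfl⟩
        · by_cases hp : p = 0
          · subst hp
            refine Or.inr (Or.inl ⟨q, ?_, hq, rfl⟩)
            by_contra hc
            exact hmin q (by simpa using hc) ⟨hpq, hx⟩
          · exfalso
            have h1 : MM n 1 (n - 1) ∈ S :=
              mMM hn hU hx (by omega) (by omega) (by omega) (by omega) (by omega)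
            apply hA _ h1 _ hP0
            have : MM n 1 (n - 1) + PP n 0 (n - 1) = PP n 0 1 := by
              simp only [MM, PP]; abel
            rw [this]
            exact PP_pos n _ _ (by omega) (by omega)
        · by_cases hp : p = 0
          · subst hp
            exact Or.inl ⟨q, hpq, hq, rfl⟩
          · refine Or.inr (Or.inr ⟨p, q, ⟨by omega, hpq, ?_, hx⟩, rfl⟩)
            by_contra hc
            have h1 : MM n 0 q ∈ S :=
              mMM hn hU hlS (by omega) (by omega) (by omega) (by omega) (by omega)
            apply hA _ h1 _ hx
            have : MM n 0 q + PP n p q = PP n 0 p := by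
              simp only [MM, PP]; abel
            rw [this]
            exact PP_pos n _ _ (by omega) (by omega)
  · rintro ⟨⟨l, Q⟩, ⟨h1, h2, hQ⟩, rfl⟩
    simp only at h1 h2 hQ
    refine ⟨setY_GG n hn l Q h1 h2 hQ, fun h => ?_, fun h => ?_⟩
    · have := h.2 _ ((mem_setY_MM n l Q h1 h2 hQ 0 (n - 1) (by omega) (by omega)).2 ⟨rfl, h2⟩)
      rw [sum_MM n _ _ (by omega) (by omega)] at this
      omega
    · have := h.2 _ ((mem_setY_PP n l Q h1 h2 hQ 0 (n - 1) (by omega) (by omega)).2 (Or.inl rfl))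
      rw [sg_PP_last n _ (by omega), sum_MM n _ _ (by omega) (by omega)] at this
      omega

theorem X3_card (n : ℕ) (hn : 3 ≤ n) : (X3 n).encard = 2 ^ (n - 2) := by
  have : n - 1 = (n - 2) + 1 := by omega
  rw [X3_eq n hn, (setY_inj n hn).encard_image, this, YY_card]

theorem GG_card (n : ℕ) (hn : 3 ≤ n) : (GG n).encard = 2 ^ n := by
  have h1 : GG n = (X1 n ∪ X2 n) ∪ X3 n := by
    ext S
    constructor
    · intro h
      by_cases h1 : S ∈ X1 n
      · exact Or.inl (Or.inl h1)
      · by_cases h2 : S ∈ X2 n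
        · exact Or.inl (Or.inr h2)
        · exact Or.inr ⟨h, h1, h2⟩
    · rintro ((h | h) | h) <;> exact h.1
  have hd : Disjoint (X1 n ∪ X2 n) (X3 n) := by
    rw [Set.disjoint_left]
    rintro S (h | h) h'
    · exact h'.2.1 h
    · exact h'.2.2 h
  rw [h1, Set.encard_union_eq hd, X3_card n hn, ← X12_card n hn,
    Set.encard_union_add_encard_inter, X2_card n hn, X1_card n hn, ← mul_two, ← pow_succ]
  congr 1
  omega

def fullQ (n : ℕ) : ℕ → ℕ → Prop := fun i j => i < j ∧ j < n

theorem fullQ_FF (n : ℕ) : fullQ n ∈ FF 0 n := by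
  refine ⟨fun i j h => ⟨by omega, h.1, h.2⟩, fun i j i' j' h _ _ h2 h3 => ⟨h3, ?_⟩⟩
  have := h.2
  omega

def U1 (n : ℕ) : Set (Fin n → ℤ) := setP n (fullQ n)
def U2 (n : ℕ) : Set (Fin n → ℤ) := sg n ⁻¹' U1 n
def U3 (n : ℕ) : Set (Fin n → ℤ) := setY n (1, fun _ _ => False)

theorem U1_X1 (n : ℕ) (hn : 3 ≤ n) : U1 n ∈ X1 n := by
  rw [X1_eq n hn]; exact ⟨_, fullQ_FF n, rfl⟩

theorem U2_X2 (n : ℕ) (hn : 3 ≤ n) : U2 n ∈ X2 n := by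
  rw [X2_image n hn]; exact ⟨_, U1_X1 n hn, rfl⟩

theorem U3_YY (n : ℕ) (hn : 3 ≤ n) : ((1, fun _ _ => False) : ℕ × (ℕ → ℕ → Prop)) ∈ YY (n - 1) := by
  refine ⟨le_rfl, by simp only; omega, ?_⟩
  rw [FF_triv _ _ (by simp)]
  rfl

theorem U3_X3 (n : ℕ) (hn : 3 ≤ n) : U3 n ∈ X3 n := by
  rw [X3_eq n hn]; exact ⟨_, U3_YY n hn, rfl⟩

theorem X1_simple (n : ℕ) (hn : 3 ≤ n) (S : Set (Fin n → ℤ)) (hS : S ∈ X1 n) (x : Fin n → ℤ)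
    (hx : x ∈ S) (hs : x ∈ simpleD n) : x = PP n (n - 2) (n - 1) ∧ S = U1 n := by
  have h1 := hS.2 x hx
  rcases (mem_simpleD n hn x).1 hs with ⟨i, hi, rfl⟩ | rfl
  · rw [sum_MM n _ _ (by omega) hi] at h1
    omega
  · refine ⟨rfl, ?_⟩
    rw [X1_eq n hn] at hS
    obtain ⟨Q, hQ, rfl⟩ := hS
    rw [mem_setP n Q 0 hQ _ _ (by omega) (by omega)] at hx
    have : Q = fullQ n := by
      ext i j
      constructor
      · intro h; exact (hQ.1 i j h).2
      · intro h
        obtain ⟨h1, h2⟩ := h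
        exact hQ.2 _ _ i j hx (by omega) (by omega) (by omega) h1
    rw [this, U1]

theorem X2_simple (n : ℕ) (hn : 3 ≤ n) (S : Set (Fin n → ℤ)) (hS : S ∈ X2 n) (x : Fin n → ℤ)
    (hx : x ∈ S) (hs : x ∈ simpleD n) : x = sg n (PP n (n - 2) (n - 1)) ∧ S = U2 n := by
  obtain ⟨h1, h2⟩ := X1_simple n hn _ ((X2_iff n hn S).1 hS) (sg n x)
    (by simpa [sg_sg] using hx) (sg_simple n hn x hs)
  constructor
  · rw [← h1, sg_sg]
  · rw [U2, ← h2, sg_pre]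

theorem X3_simple (n : ℕ) (hn : 3 ≤ n) (S : Set (Fin n → ℤ)) (hS : S ∈ X3 n) (x : Fin n → ℤ)
    (hx : x ∈ S) (hs : x ∈ simpleD n) : x = MM n 0 1 ∧ S = U3 n := by
  rw [X3_eq n hn] at hS
  obtain ⟨⟨l, Q⟩, ⟨h1, h2, hQ⟩, rfl⟩ := hS
  simp only at h1 h2 hQ
  rcases (mem_simpleD n hn x).1 hs with ⟨i, hi, rfl⟩ | rfl
  · rw [mem_setY_MM n l Q h1 h2 hQ _ _ (by omega) hi] at hx
    obtain ⟨rfl, hl⟩ := hx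
    have : l = 1 := by omega
    subst this
    refine ⟨rfl, ?_⟩
    rw [FF_triv _ _ (by omega)] at hQ
    rw [Set.mem_singleton_iff.1 hQ, U3]
  · rw [mem_setY_PP n l Q h1 h2 hQ _ _ (by omega) (by omega)] at hx
    rcases hx with hx | hx
    · omega
    · have := hQ.1 _ _ hx
      omega

theorem last_simple (n : ℕ) (hn : 3 ≤ n) : PP n (n - 2) (n - 1) ∈ simpleD n :=
  (mem_simpleD n hn _).2 (Or.inr rfl)

theorem last_U1 (n : ℕ) (hn : 3 ≤ n) : PP n (n - 2) (n - 1) ∈ U1 n :=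
  ⟨_, _, ⟨by omega, by omega⟩, rfl⟩

theorem U1_inter (n : ℕ) (hn : 3 ≤ n) : (U1 n ∩ simpleD n).ncard = 1 := by
  rw [Set.ncard_eq_one]
  refine ⟨PP n (n - 2) (n - 1), ?_⟩
  ext x
  constructor
  · rintro ⟨h1, h2⟩; exact (X1_simple n hn _ (U1_X1 n hn) x h1 h2).1
  · rintro rfl; exact ⟨last_U1 n hn, last_simple n hn⟩

theorem U2_inter (n : ℕ) (hn : 3 ≤ n) : (U2 n ∩ simpleD n).ncard = 1 := by
  rw [Set.ncard_eq_one]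
  refine ⟨sg n (PP n (n - 2) (n - 1)), ?_⟩
  ext x
  constructor
  · rintro ⟨h1, h2⟩; exact (X2_simple n hn _ (U2_X2 n hn) x h1 h2).1
  · rintro rfl
    refine ⟨?_, sg_simple n hn _ (last_simple n hn)⟩
    simpa [U2, sg_sg] using last_U1 n hn

theorem U3_inter (n : ℕ) (hn : 3 ≤ n) : (U3 n ∩ simpleD n).ncard = 1 := by
  rw [Set.ncard_eq_one]
  refine ⟨MM n 0 1, ?_⟩
  ext x
  constructor
  · rintro ⟨h1, h2⟩; exact (X3_simple n hn _ (U3_X3 n hn) x h1 h2).1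
  · rintro rfl
    exact ⟨Or.inr (Or.inl ⟨1, le_rfl, by omega, rfl⟩),
      (mem_simpleD n hn _).2 (Or.inl ⟨0, by omega, rfl⟩)⟩

theorem U12_ne (n : ℕ) (hn : 3 ≤ n) : U1 n ≠ U2 n := by
  intro h
  have h1 := (U2_X2 n hn).2 (PP n (n - 2) (n - 1)) (by rw [← h]; exact last_U1 n hn)
  rw [sg_PP_last n _ (by omega), sum_MM n _ _ (by omega) (by omega)] at h1
  omega

theorem U123_card (n : ℕ) (hn : 3 ≤ n) : ({U1 n, U2 n, U3 n} : Set (Set (Fin n → ℤ))).ncard = 3 := by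
  rw [Set.ncard_eq_three]
  refine ⟨_, _, _, U12_ne n hn, ?_, ?_, rfl⟩
  · intro h; exact (U3_X3 n hn).2.1 (h ▸ U1_X1 n hn)
  · intro h; exact (U3_X3 n hn).2.2 (h ▸ U2_X2 n hn)

theorem GG_simple (n : ℕ) (hn : 3 ≤ n) (S : Set (Fin n → ℤ)) (hS : S ∈ GG n) :
    (S ∩ simpleD n).ncard = 0 ∧ S ∉ ({U1 n, U2 n, U3 n} : Set (Set (Fin n → ℤ))) ∨
    (S ∩ simpleD n).ncard = 1 ∧ S ∈ ({U1 n, U2 n, U3 n} : Set (Set (Fin n → ℤ))) := by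
  by_cases h : S ∈ ({U1 n, U2 n, U3 n} : Set (Set (Fin n → ℤ)))
  · right
    refine ⟨?_, h⟩
    rcases h with rfl | rfl | rfl
    · exact U1_inter n hn
    · exact U2_inter n hn
    · exact U3_inter n hn
  · left
    refine ⟨?_, h⟩
    have : S ∩ simpleD n = ∅ := by
      rw [Set.eq_empty_iff_forall_notMem]
      rintro x ⟨h1, h2⟩
      apply h
      by_cases hX1 : S ∈ X1 n
      · exact Or.inl (X1_simple n hn S hX1 x h1 h2).2
      · by_cases hX2 : S ∈ X2 n
        · exact Or.inr (Or.inl (X2_simple n hn S hX2 x h1 h2).2)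
        · exact Or.inr (Or.inr (X3_simple n hn S ⟨hS, hX1, hX2⟩ x h1 h2).2)
    rw [this, Set.ncard_empty]

theorem stmt_16 (n j : ℕ) (hn : 3 ≤ n) :
    Nat.card {S : Set (Fin n → ℤ) //
        isUpperD n S ∧ (∀ a ∈ S, ∀ b ∈ S, a + b ∉ posD n) ∧ (S ∩ simpleD n).ncard = j} =
      if j = 0 then 2 ^ n - 3 else if j = 1 then 3 else 0 := by
  have hsub : ({U1 n, U2 n, U3 n} : Set (Set (Fin n → ℤ))) ⊆ GG n := by
    rintro S (rfl | rfl | rfl)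
    · exact (U1_X1 n hn).1
    · exact (U2_X2 n hn).1
    · exact (U3_X3 n hn).1
  have hcard : (GG n).ncard = 2 ^ n := by
    rw [Set.ncard, GG_card n hn]
    norm_cast
  have e : Nat.card {S : Set (Fin n → ℤ) //
        isUpperD n S ∧ (∀ a ∈ S, ∀ b ∈ S, a + b ∉ posD n) ∧ (S ∩ simpleD n).ncard = j} =
      ({S | S ∈ GG n ∧ (S ∩ simpleD n).ncard = j} : Set (Set (Fin n → ℤ))).ncard := by
    rw [← Nat.card_coe_set_eq]
    exact Nat.card_congr (Equiv.subtypeEquivRight fun S =>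
      ⟨fun h => ⟨⟨h.1, h.2.1⟩, h.2.2⟩, fun h => ⟨h.1.1, h.1.2, h.2⟩⟩)
  rw [e]
  split_ifs with h0 h1
  · subst h0
    have : ({S | S ∈ GG n ∧ (S ∩ simpleD n).ncard = 0} : Set (Set (Fin n → ℤ))) =
        GG n \ {U1 n, U2 n, U3 n} := by
      ext S
      constructor
      · rintro ⟨h, h'⟩
        rcases GG_simple n hn S h with h2 | h2
        · exact ⟨h, h2.2⟩
        · omega
      · rintro ⟨h, h'⟩
        rcases GG_simple n hn S h with h2 | h2
        · exact ⟨h, h2.1⟩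
        · exact (h' h2.2).elim
    rw [this, Set.ncard_sdiff hsub (by simp), hcard, U123_card n hn]
  · subst h1
    rw [← U123_card n hn]
    congr 1
    ext S
    constructor
    · rintro ⟨h, h'⟩
      rcases GG_simple n hn S h with h2 | h2
      · omega
      · exact h2.2
    · intro h
      rcases GG_simple n hn S (hsub h) with h2 | h2
      · exact (h2.2 h).elim
      · exact ⟨hsub h, h2.1⟩
  · have : ({S | S ∈ GG n ∧ (S ∩ simpleD n).ncard = j} : Set (Set (Fin n → ℤ))) = ∅ := by
      rw [Set.eq_empty_iff_forall_notMem]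
      rintro S ⟨h, h'⟩
      rcases GG_simple n hn S h with h2 | h2 <;> omega
    rw [this, Set.ncard_empty]
end
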